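/- arXiv:1906.11274 — 2 statements merged into one kernel-verified Lean document; each statement's English description precedes it below -/
import Mathlib

section
/- Let 1 < p < 5 and let f : ℝ → ℝ satisfy |f(s)| ≤ C·s^((p-1)/2) for all s ≥ 0. There exists ε > 0 such that: if u : ℝ × ℝ → ℂ is a global solution of i∂ₜu + ∂ₓₓu = f(|u|²)u which is smooth, odd in x (u(t,-x) = -u(t,x) for all t), with u(t,·) in the Schwartz class in x for each t, and satisfying sup_{t∈ℝ} (‖u(t,·)‖_{L²(ℝ)}² + ‖∂ₓu(t,·)‖_{L²(ℝ)}²) ≤ ε², then for every bounded interval I ⊂ ℝ one has lim_{t→∞} ( ‖u(t,·)‖_{L²(I)} + sup_{x∈I}|u(t,x)| ) = 0. -/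
open MeasureTheory Real Filter


namespace OddNLS

lemma leibniz (G G' : ℝ → ℝ → ℝ) (R : ℝ)
    (hG : ∀ t, Continuous (G t)) (hG' : Continuous (Function.uncurry G'))
    (hd : ∀ t x, HasDerivAt (fun s => G s x) (G' t x) t) (t : ℝ) :
    HasDerivAt (fun s => ∫ x in (0:ℝ)..R, G s x) (∫ x in (0:ℝ)..R, G' t x) t := by
  obtain ⟨M, hM⟩ := ((isCompact_Icc (a := t - 1) (b := t + 1)).prod
    (isCompact_uIcc (a := (0:ℝ)) (b := R))).exists_bound_of_continuousOn hG'.continuousOn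
  have hc : Continuous (G' t) := hG'.comp (by fun_prop : Continuous fun x : ℝ => (t, x))
  refine (intervalIntegral.hasDerivAt_integral_of_dominated_loc_of_deriv_le
    (F := G) (F' := G') (bound := fun _ => M) (s := Set.Icc (t-1) (t+1))
    (Icc_mem_nhds (by linarith) (by linarith)) ?_ ?_ ?_ ?_ ?_ ?_).2
  · exact Eventually.of_forall fun s => (hG s).aestronglyMeasurable
  · exact (hG t).intervalIntegrable _ _
  · exact hc.aestronglyMeasurable
  · refine Eventually.of_forall fun x hx s hs => ?_
    exact hM (s, x) ⟨hs, Set.uIoc_subset_uIcc hx⟩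
  · exact intervalIntegrable_const
  · exact Eventually.of_forall fun x _ s _ => hd s x

/-- Fixed-time integral identity for the truncated virial functional. -/
lemma flux {a b ax bx axx bxx at' bt axt bxt h F φ φ1 φ2 φ3 : ℝ → ℝ} {R : ℝ}
    (ha : ∀ x, HasDerivAt a (ax x) x) (hb : ∀ x, HasDerivAt b (bx x) x)
    (hax : ∀ x, HasDerivAt ax (axx x) x) (hbx : ∀ x, HasDerivAt bx (bxx x) x)
    (hat : ∀ x, HasDerivAt at' (axt x) x) (hbt : ∀ x, HasDerivAt bt (bxt x) x)
    (hF : ∀ x, HasDerivAt F (h x * (2 * a x * ax x + 2 * b x * bx x)) x)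
    (hφ : ∀ x, HasDerivAt φ (φ1 x) x) (hφ1 : ∀ x, HasDerivAt φ1 (φ2 x) x)
    (hφ2 : ∀ x, HasDerivAt φ2 (φ3 x) x) (hφ3 : Continuous φ3)
    (cxt : Continuous axt) (dxt : Continuous bxt) (ch : Continuous h)
    (e1 : ∀ x, - bt x + axx x = h x * a x) (e2 : ∀ x, at' x + bxx x = h x * b x)
    (a0 : a 0 = 0) (b0 : b 0 = 0) (φ0 : φ 0 = 0) (φR : φ R = 0) (phiOneR : φ1 R = 0)
    (phiTwoR : φ2 R = 0) :
    ∫ x in (0:ℝ)..R, φ x * (at' x * bx x + a x * bxt x - bt x * ax x - b x * axt x)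
      = ∫ x in (0:ℝ)..R, (φ1 x * (2 * (ax x ^ 2 + bx x ^ 2) + h x * (a x ^ 2 + b x ^ 2) - F x)
          - 1 / 2 * φ3 x * (a x ^ 2 + b x ^ 2)) := by
  have c {k k' : ℝ → ℝ} (hk : ∀ x, HasDerivAt k (k' x) x) : Continuous k :=
    continuous_iff_continuousAt.2 fun x => (hk x).continuousAt
  have ca := c ha; have cb := c hb; have cax := c hax; have cbx := c hbx
  have cat := c hat; have cbt := c hbt; have cF := c hF
  have cφ := c hφ; have cφ1 := c hφ1; have cφ2 := c hφ2
  have hQ : ∀ x, HasDerivAt (fun x => φ x * (a x * bt x - b x * at' x)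
      - φ x * (ax x ^ 2 + bx x ^ 2) - φ1 x * (a x * ax x + b x * bx x)
      + 1 / 2 * (φ2 x * (a x ^ 2 + b x ^ 2)) + φ x * F x)
      (φ x * (at' x * bx x + a x * bxt x - bt x * ax x - b x * axt x)
       - (φ1 x * (2 * (ax x ^ 2 + bx x ^ 2) + h x * (a x ^ 2 + b x ^ 2) - F x)
          - 1 / 2 * φ3 x * (a x ^ 2 + b x ^ 2))) x := by
    intro x
    have := (((((hφ x).mul (((ha x).mul (hbt x)).sub ((hb x).mul (hat x)))).sub
      ((hφ x).mul (((hax x).pow 2).add ((hbx x).pow 2)))).sub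
      ((hφ1 x).mul (((ha x).mul (hax x)).add ((hb x).mul (hbx x))))).add
      (((hφ2 x).mul (((ha x).pow 2).add ((hb x).pow 2))).const_mul (1/2))).add
      ((hφ x).mul (hF x))
    refine this.congr_deriv ?_
    have E1 : axx x = h x * a x + bt x := by linarith [e1 x]
    have E2 : bxx x = h x * b x - at' x := by linarith [e2 x]
    simp only [E1, E2, Pi.mul_apply, Pi.add_apply, Pi.sub_apply, Pi.pow_apply]
    push_cast
    ring
  have i1 : Continuous fun x =>
      φ x * (at' x * bx x + a x * bxt x - bt x * ax x - b x * axt x) := by fun_prop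
  have i2 : Continuous fun x =>
      (φ1 x * (2 * (ax x ^ 2 + bx x ^ 2) + h x * (a x ^ 2 + b x ^ 2) - F x)
          - 1 / 2 * φ3 x * (a x ^ 2 + b x ^ 2)) := by fun_prop
  have := intervalIntegral.integral_eq_sub_of_hasDerivAt (a := 0) (b := R)
    (fun x _ => hQ x) ((i1.sub i2).intervalIntegrable _ _)
  rw [intervalIntegral.integral_sub (i1.intervalIntegrable _ _) (i2.intervalIntegrable _ _)] at this
  simp only [a0, b0, φ0, φR, phiOneR, phiTwoR] at this
  norm_num at this
  linarith

/-- Continuity of `f ∘ |u|²`. -/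
lemma h_cont {f : ℝ → ℝ} {C r : ℝ} (hr : 1 < r)
    (hf : ∀ s : ℝ, 0 ≤ s → |f s| ≤ C * s ^ (r - 1))
    {a b n1 n2 : ℝ → ℝ} (ca : Continuous a) (cb : Continuous b) (c1 : Continuous n1)
    (c2 : Continuous n2)
    (e1 : ∀ x, n1 x = f (a x ^ 2 + b x ^ 2) * a x)
    (e2 : ∀ x, n2 x = f (a x ^ 2 + b x ^ 2) * b x) :
    Continuous fun x => f (a x ^ 2 + b x ^ 2) := by
  rw [continuous_iff_continuousAt]
  intro x
  have cg : Continuous fun x => a x ^ 2 + b x ^ 2 := by fun_prop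
  by_cases h0 : a x ^ 2 + b x ^ 2 = 0
  · have f0 : f 0 = 0 := by
      have := hf 0 le_rfl
      rw [Real.zero_rpow (by linarith), mul_zero] at this
      exact abs_eq_zero.1 (le_antisymm this (abs_nonneg _))
    change Tendsto _ _ (nhds (f (a x ^ 2 + b x ^ 2)))
    rw [h0, f0]
    refine squeeze_zero_norm (a := fun y => C * (a y ^ 2 + b y ^ 2) ^ (r - 1))
      (fun y => hf _ (by positivity)) ?_
    have : Continuous fun y => C * (a y ^ 2 + b y ^ 2) ^ (r - 1) :=
      continuous_const.mul (cg.rpow_const fun _ => Or.inr (by linarith))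
    have h2 := this.tendsto x
    simpa [h0, Real.zero_rpow (by linarith : r - 1 ≠ 0)] using h2
  · have : (fun x => f (a x ^ 2 + b x ^ 2)) =ᶠ[nhds x]
        fun x => (n1 x * a x + n2 x * b x) / (a x ^ 2 + b x ^ 2) := by
      filter_upwards [cg.continuousAt.eventually_ne h0] with y hy
      rw [e1, e2, eq_div_iff hy]; ring
    refine ContinuousAt.congr ?_ this.symm
    exact ContinuousAt.div (by fun_prop) cg.continuousAt h0

/-- The primitive of the nonlinearity along the solution and its size. -/
lemma F_bound {f : ℝ → ℝ} {C r : ℝ} (hr : 1 < r) (hC : 0 ≤ C)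
    (hf : ∀ s : ℝ, 0 ≤ s → |f s| ≤ C * s ^ (r - 1))
    {g g' : ℝ → ℝ} (hg : ∀ x, HasDerivAt g (g' x) x) (cg' : Continuous g')
    (g0 : g 0 = 0) (gn : ∀ x, 0 ≤ g x) (ch : Continuous fun x => f (g x)) (x : ℝ) :
    |∫ y in (0:ℝ)..x, f (g y) * g' y| ≤ C * g x ^ r := by
  have cg : Continuous g := continuous_iff_continuousAt.2 fun x => (hg x).continuousAt
  have hq : ContinuousOn f (Set.image g (Set.uIcc 0 x)) := by
    set K := Set.uIcc (0:ℝ) x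
    have hK : IsCompact K := isCompact_uIcc
    have : CompactSpace K := isCompact_iff_compactSpace.1 hK
    let G : K → Set.image g K := fun y => ⟨g y, Set.mem_image_of_mem g y.2⟩
    have cG : Continuous G := by
      apply Continuous.subtype_mk
      exact cg.comp continuous_subtype_val
    have sG : Function.Surjective G := by
      rintro ⟨_, y, hy, rfl⟩; exact ⟨⟨y, hy⟩, rfl⟩
    have qG : Topology.IsQuotientMap G := cG.isClosedMap.isQuotientMap cG sG
    rw [continuousOn_iff_continuous_domRestrict, qG.continuous_iff]
    exact ch.comp continuous_subtype_val
  have := intervalIntegral.integral_comp_mul_deriv'' (f := g) (f' := g') (g := f) (a := 0) (b := x)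
    cg.continuousOn (fun y _ => (hg y).hasDerivWithinAt) cg'.continuousOn hq
  simp only [Function.comp] at this
  rw [this, g0]
  have := intervalIntegral.norm_integral_le_of_norm_le_const (a := 0) (b := g x) (f := f)
    (C := C * g x ^ (r - 1)) (by
      intro s hs
      rw [Set.uIoc_of_le (gn x)] at hs
      refine (hf s hs.1.le).trans ?_
      gcongr
      · exact hs.1.le
      · exact hs.2)
  rw [sub_zero, abs_of_nonneg (gn x), Real.norm_eq_abs] at this
  refine this.trans (le_of_eq ?_)
  rcases (gn x).eq_or_lt with h | h
  · rw [← h, Real.zero_rpow (by linarith : r ≠ 0)]; simp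
  · rw [mul_assoc, ← Real.rpow_add_one h.ne']; ring_nf

end OddNLS


namespace OddNLS

noncomputable def φ0 (R x : ℝ) : ℝ := (1 - exp (-x)) * (1 - x / R) ^ 3
noncomputable def φ1 (R x : ℝ) : ℝ :=
  exp (-x) * (1 - x / R) ^ 3 + (1 - exp (-x)) * (-(3 / R) * (1 - x / R) ^ 2)
noncomputable def φ2 (R x : ℝ) : ℝ :=
  - exp (-x) * (1 - x / R) ^ 3 + 2 * (exp (-x) * (-(3 / R) * (1 - x / R) ^ 2))
    + (1 - exp (-x)) * (6 / R ^ 2 * (1 - x / R))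
noncomputable def φ3 (R x : ℝ) : ℝ :=
  exp (-x) * (1 - x / R) ^ 3 - 3 * (exp (-x) * (-(3 / R) * (1 - x / R) ^ 2))
    + 3 * (exp (-x) * (6 / R ^ 2 * (1 - x / R))) + (1 - exp (-x)) * (-(6 / R ^ 3))

lemma hasDeriv_exp_neg (x : ℝ) : HasDerivAt (fun x => exp (-x)) (-exp (-x)) x := by
  simpa using (hasDerivAt_neg x).exp

lemma hasDeriv_lin (R x : ℝ) : HasDerivAt (fun x => 1 - x / R) (-(1 / R)) x := by
  simpa using ((hasDerivAt_id x).div_const R).const_sub 1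

lemma φ0_deriv (R x : ℝ) : HasDerivAt (φ0 R) (φ1 R x) x := by
  have e := hasDeriv_exp_neg x
  have l := hasDeriv_lin R x
  refine ((e.const_sub 1).mul (l.pow 3)).congr_deriv ?_
  simp only [φ1, Pi.pow_apply]; push_cast; ring

lemma φ1_deriv (R x : ℝ) : HasDerivAt (φ1 R) (φ2 R x) x := by
  have e := hasDeriv_exp_neg x
  have l := hasDeriv_lin R x
  refine ((e.mul (l.pow 3)).add
    ((e.const_sub 1).mul ((l.pow 2).const_mul (-(3 / R))))).congr_deriv ?_
  simp only [φ2, Pi.pow_apply]; push_cast; ring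

lemma φ2_deriv (R x : ℝ) : HasDerivAt (φ2 R) (φ3 R x) x := by
  have e := hasDeriv_exp_neg x
  have l := hasDeriv_lin R x
  refine (((e.neg.mul (l.pow 3)).add
    ((e.mul ((l.pow 2).const_mul (-(3 / R)))).const_mul 2)).add
    ((e.const_sub 1).mul (l.const_mul (6 / R ^ 2)))).congr_deriv ?_
  simp only [φ3, Pi.pow_apply, Pi.neg_apply]; push_cast; ring

lemma φ3_cont (R : ℝ) : Continuous (φ3 R) := by
  unfold φ3; fun_prop

lemma x_exp_le (x : ℝ) : x * exp (-x) ≤ 1 := by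
  have h := add_one_le_exp x
  have h2 : exp x * exp (-x) = 1 := by rw [← exp_add]; simp
  nlinarith [exp_pos (-x)]

set_option maxHeartbeats 1000000 in
lemma φ_bounds {R x : ℝ} (hR : 1 ≤ R) (hx : 0 ≤ x) (hxR : x ≤ R) :
    |φ0 R x| ≤ 1 ∧ |φ1 R x - exp (-x)| ≤ 6 / R ∧ |φ3 R x - exp (-x)| ≤ 36 / R := by
  have hR0 : 0 < R := by linarith
  set E := exp (-x) with hE
  set d := 1 / R with hd
  have d0 : 0 < d := by positivity
  have d1 : d ≤ 1 := by rw [hd, div_le_one hR0]; exact hR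
  set y := 1 - x / R with hy
  have hxd : x / R = x * d := by rw [hd]; ring
  have y1 : y ≤ 1 := by rw [hy]; have : 0 ≤ x / R := by positivity
                        linarith
  have y0 : 0 ≤ y := by rw [hy]; have : x / R ≤ 1 := (div_le_one hR0).2 hxR
                        linarith
  have E0 : 0 < E := exp_pos _
  have E1 : E ≤ 1 := by rw [hE]; exact exp_le_one_iff.2 (by linarith)
  have hEx : E * (1 - y) ≤ d := by
    have := x_exp_le x
    rw [hy, hxd]; nlinarith
  have y2 : y ^ 2 ≤ 1 := pow_le_one₀ y0 y1
  have y3 : y ^ 3 ≤ 1 := pow_le_one₀ y0 y1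
  have y20 : 0 ≤ y ^ 2 := by positivity
  have y30 : 0 ≤ y ^ 3 := by positivity
  have hB : 1 - y ^ 3 ≤ 3 * (1 - y) := by nlinarith [sq_nonneg (1 - y), mul_nonneg y0 (sq_nonneg (1-y))]
  have hEB : E * (1 - y ^ 3) ≤ 3 * d := by nlinarith
  have hEB0 : 0 ≤ E * (1 - y ^ 3) := by apply mul_nonneg E0.le; linarith
  have p1 : 0 ≤ (1 - E) * (d * y ^ 2) := by apply mul_nonneg; linarith; positivity
  have p1' : (1 - E) * (d * y ^ 2) ≤ d := by
    have : d * y ^ 2 ≤ d := by nlinarith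
    have h2 : 0 ≤ d * y ^ 2 := by positivity
    nlinarith
  have p2 : 0 ≤ E * (d * y ^ 2) := by positivity
  have p2' : E * (d * y ^ 2) ≤ d := by
    have : d * y ^ 2 ≤ d := by nlinarith
    have h2 : 0 ≤ d * y ^ 2 := by positivity
    nlinarith
  have dd : d ^ 2 ≤ d := by nlinarith
  have ddd : d ^ 3 ≤ d := by nlinarith
  have p3 : 0 ≤ E * (d ^ 2 * y) := by positivity
  have p3' : E * (d ^ 2 * y) ≤ d := by
    have : d ^ 2 * y ≤ d := by nlinarith [sq_nonneg d]
    have h2 : 0 ≤ d ^ 2 * y := by positivity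
    nlinarith
  have p4 : 0 ≤ (1 - E) * d ^ 3 := by apply mul_nonneg; linarith; positivity
  have p4' : (1 - E) * d ^ 3 ≤ d := by
    have h2 : 0 ≤ d ^ 3 := by positivity
    nlinarith
  refine ⟨?_, ?_, ?_⟩
  · unfold φ0
    rw [← hE, ← hy, abs_of_nonneg (mul_nonneg (by linarith) y30)]
    exact mul_le_one₀ (by linarith) y30 y3
  · have : φ1 R x - E = - (E * (1 - y ^ 3)) - 3 * ((1 - E) * (d * y ^ 2)) := by
      unfold φ1; rw [← hE, ← hy, hd]; ring
    rw [this, show 6 / R = 6 * d by rw [hd]; ring, abs_le]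
    constructor <;> linarith
  · have : φ3 R x - E = - (E * (1 - y ^ 3)) + 9 * (E * (d * y ^ 2)) + 18 * (E * (d ^ 2 * y))
        - 6 * ((1 - E) * d ^ 3) := by
      unfold φ3; rw [← hE, ← hy, hd]; ring
    rw [this, show 36 / R = 36 * d by rw [hd]; ring, abs_le]
    constructor <;> linarith

/-- Completing the square in the virial quadratic form. -/
lemma quad {a b ax bx : ℝ → ℝ} {R : ℝ}
    (ha : ∀ x, HasDerivAt a (ax x) x) (hb : ∀ x, HasDerivAt b (bx x) x)
    (cax : Continuous ax) (cbx : Continuous bx) (a0 : a 0 = 0) (b0 : b 0 = 0) :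
    2 * ∫ x in (0:ℝ)..R, exp (-x) * ((ax x - a x / 2) ^ 2 + (bx x - b x / 2) ^ 2)
     ≤ ∫ x in (0:ℝ)..R, exp (-x) * (2 * (ax x ^ 2 + bx x ^ 2) - 1 / 2 * (a x ^ 2 + b x ^ 2)) := by
  have ca : Continuous a := continuous_iff_continuousAt.2 fun x => (ha x).continuousAt
  have cb : Continuous b := continuous_iff_continuousAt.2 fun x => (hb x).continuousAt
  have hQ : ∀ x, HasDerivAt (fun x => exp (-x) * (a x ^ 2 + b x ^ 2))
      (exp (-x) * (2 * (ax x ^ 2 + bx x ^ 2) - 1 / 2 * (a x ^ 2 + b x ^ 2))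
       - 2 * (exp (-x) * ((ax x - a x / 2) ^ 2 + (bx x - b x / 2) ^ 2))) x := by
    intro x
    refine ((hasDeriv_exp_neg x).mul (((ha x).pow 2).add ((hb x).pow 2))).congr_deriv ?_
    simp only [Pi.add_apply, Pi.pow_apply]; push_cast; ring
  have i1 : Continuous fun x =>
    exp (-x) * (2 * (ax x ^ 2 + bx x ^ 2) - 1 / 2 * (a x ^ 2 + b x ^ 2)) := by fun_prop
  have i2 : Continuous fun x =>
    2 * (exp (-x) * ((ax x - a x / 2) ^ 2 + (bx x - b x / 2) ^ 2)) := by fun_prop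
  have := intervalIntegral.integral_eq_sub_of_hasDerivAt (a := 0) (b := R)
    (fun x _ => hQ x) ((i1.sub i2).intervalIntegrable _ _)
  rw [intervalIntegral.integral_sub (i1.intervalIntegrable _ _) (i2.intervalIntegrable _ _),
    intervalIntegral.integral_const_mul] at this
  simp only [a0, b0] at this
  have h : 0 ≤ exp (-R) * (a R ^ 2 + b R ^ 2) := by positivity
  norm_num at this
  linarith

set_option maxHeartbeats 2000000 in
/-- Nonlinear term controlled by the quadratic form. -/
lemma nonlin {a b ax bx : ℝ → ℝ} {R r E : ℝ} (hR : 1 ≤ R) (hr : 1 < r) (hE1 : E ≤ 1)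
    (ha : ∀ x, HasDerivAt a (ax x) x) (hb : ∀ x, HasDerivAt b (bx x) x)
    (cax : Continuous ax) (cbx : Continuous bx) (a0 : a 0 = 0) (b0 : b 0 = 0)
    (hg : ∀ x, 0 ≤ x → a x ^ 2 + b x ^ 2 ≤ E) :
    ∫ x in (0:ℝ)..R, exp (-x) * (a x ^ 2 + b x ^ 2) ^ r
     ≤ 2 / (r - 1) * (1 / R) + 4 * r ^ 2 / (r - 1) ^ 2 * E ^ (r - 1) *
      ∫ x in (0:ℝ)..R, exp (-x) * ((ax x - a x / 2) ^ 2 + (bx x - b x / 2) ^ 2) := by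
  have ca : Continuous a := continuous_iff_continuousAt.2 fun x => (ha x).continuousAt
  have cb : Continuous b := continuous_iff_continuousAt.2 fun x => (hb x).continuousAt
  have hr1 : 0 < r - 1 := by linarith
  have cg : Continuous fun x => a x ^ 2 + b x ^ 2 := by fun_prop
  have cgr : Continuous fun x => (a x ^ 2 + b x ^ 2) ^ r := cg.rpow_const fun _ => Or.inr (by linarith)
  have cgr1 : Continuous fun x => (a x ^ 2 + b x ^ 2) ^ (r - 1) :=
    cg.rpow_const fun _ => Or.inr (by linarith)
  have hQ : ∀ x, HasDerivAt (fun x => exp (-x) * (a x ^ 2 + b x ^ 2) ^ r)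
      (- exp (-x) * (a x ^ 2 + b x ^ 2) ^ r + exp (-x) *
        ((2 * a x * ax x + 2 * b x * bx x) * r * (a x ^ 2 + b x ^ 2) ^ (r - 1))) x := by
    intro x
    have h1 : HasDerivAt (fun x => a x ^ 2 + b x ^ 2) (2 * a x * ax x + 2 * b x * bx x) x := by
      refine (((ha x).pow 2).add ((hb x).pow 2)).congr_deriv ?_
      push_cast; ring
    exact (hasDeriv_exp_neg x).mul (h1.rpow_const (Or.inr hr.le))
  have i1 : Continuous fun x => (- exp (-x) * (a x ^ 2 + b x ^ 2) ^ r + exp (-x) *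
        ((2 * a x * ax x + 2 * b x * bx x) * r * (a x ^ 2 + b x ^ 2) ^ (r - 1))) := by fun_prop
  have key := intervalIntegral.integral_eq_sub_of_hasDerivAt (a := 0) (b := R)
    (fun x _ => hQ x) (i1.intervalIntegrable _ _)
  simp only [a0, b0] at key
  norm_num at key
  rw [Real.zero_rpow (by linarith), sub_zero] at key
  -- pointwise Young
  have pt : ∀ x ∈ Set.Icc 0 R, (r - 1) / 2 * (exp (-x) * (a x ^ 2 + b x ^ 2) ^ r)
      - 2 * r ^ 2 / (r - 1) * E ^ (r - 1) *
        (exp (-x) * ((ax x - a x / 2) ^ 2 + (bx x - b x / 2) ^ 2)) ≤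
      -(exp (-x) * (a x ^ 2 + b x ^ 2) ^ r) + exp (-x) *
        ((2 * a x * ax x + 2 * b x * bx x) * r * (a x ^ 2 + b x ^ 2) ^ (r - 1)) := by
    intro x hx
    have hgx := hg x hx.1
    have hgn : 0 ≤ a x ^ 2 + b x ^ 2 := by positivity
    have hpow : (a x ^ 2 + b x ^ 2) ^ r = (a x ^ 2 + b x ^ 2) ^ (r - 1) * (a x ^ 2 + b x ^ 2) := by
      rcases hgn.eq_or_lt with h | h
      · rw [← h, Real.zero_rpow (by linarith : r ≠ 0)]; simp
      · rw [← Real.rpow_add_one h.ne']; ring_nf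
    have hG : (a x ^ 2 + b x ^ 2) ^ (r - 1) ≤ E ^ (r - 1) :=
      Real.rpow_le_rpow hgn hgx hr1.le
    have hG0 : 0 ≤ (a x ^ 2 + b x ^ 2) ^ (r - 1) := Real.rpow_nonneg hgn _
    rw [hpow]
    set G := (a x ^ 2 + b x ^ 2) ^ (r - 1)
    set v := ax x - a x / 2 with hv
    set w := bx x - b x / 2 with hw
    have hav : ax x = v + a x / 2 := by rw [hv]; ring
    have hbw : bx x = w + b x / 2 := by rw [hw]; ring
    have ex := exp_pos (-x)
    have q : 0 ≤ (r - 1) / 2 * (a x ^ 2 + b x ^ 2) + 2 * r ^ 2 / (r - 1) * (v ^ 2 + w ^ 2)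
        + 2 * r * (a x * v + b x * w) := by
      have : (r - 1) / 2 * (a x ^ 2 + b x ^ 2) + 2 * r ^ 2 / (r - 1) * (v ^ 2 + w ^ 2)
        + 2 * r * (a x * v + b x * w) = 1 / (2 * (r - 1)) *
          (((r - 1) * a x + 2 * r * v) ^ 2 + ((r - 1) * b x + 2 * r * w) ^ 2) := by
        field_simp; ring
      rw [this]; positivity
    have q1 : 2 * r ^ 2 / (r - 1) * G * (v ^ 2 + w ^ 2) ≤
        2 * r ^ 2 / (r - 1) * E ^ (r - 1) * (v ^ 2 + w ^ 2) := by gcongr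
    have q2 := mul_nonneg hG0 q
    have q3 : 0 ≤ exp (-x) * (-(G * (a x ^ 2 + b x ^ 2)) + (2 * a x * ax x + 2 * b x * bx x) * r * G
      - ((r - 1) / 2 * (G * (a x ^ 2 + b x ^ 2))
        - 2 * r ^ 2 / (r - 1) * E ^ (r - 1) * (v ^ 2 + w ^ 2))) := by
      apply mul_nonneg ex.le
      rw [hav, hbw]
      nlinarith
    nlinarith
  have c1 : Continuous fun x => (r - 1) / 2 * (exp (-x) * (a x ^ 2 + b x ^ 2) ^ r) := by fun_prop
  have c2 : Continuous fun x => 2 * r ^ 2 / (r - 1) * E ^ (r - 1) *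
        (exp (-x) * ((ax x - a x / 2) ^ 2 + (bx x - b x / 2) ^ 2)) := by fun_prop
  have i1' : Continuous fun x => (-(exp (-x) * (a x ^ 2 + b x ^ 2) ^ r) + exp (-x) *
        ((2 * a x * ax x + 2 * b x * bx x) * r * (a x ^ 2 + b x ^ 2) ^ (r - 1))) := by fun_prop
  have mono := intervalIntegral.integral_mono_on (μ := volume) (by linarith : (0:ℝ) ≤ R)
    ((c1.sub c2).intervalIntegrable _ _) (i1'.intervalIntegrable _ _) pt
  simp only [Pi.sub_apply] at mono
  rw [key, intervalIntegral.integral_sub (c1.intervalIntegrable _ _) (c2.intervalIntegrable _ _),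
    intervalIntegral.integral_const_mul, intervalIntegral.integral_const_mul] at mono
  have hbd : exp (-R) * (a R ^ 2 + b R ^ 2) ^ r ≤ 1 / R := by
    have h1 : (a R ^ 2 + b R ^ 2) ^ r ≤ 1 :=
      Real.rpow_le_one (by positivity) ((hg R (by linarith)).trans hE1) (by linarith)
    have h2 := x_exp_le R
    have h3 : exp (-R) ≤ 1 / R := by rw [le_div_iff₀ (by linarith)]; linarith
    have := exp_pos (-R)
    nlinarith
  set X := ∫ x in (0:ℝ)..R, exp (-x) * (a x ^ 2 + b x ^ 2) ^ r
  set B := ∫ x in (0:ℝ)..R, exp (-x) * ((ax x - a x / 2) ^ 2 + (bx x - b x / 2) ^ 2)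
  have m2 : (r - 1) / 2 * X ≤ 1 / R + 2 * r ^ 2 / (r - 1) * E ^ (r - 1) * B := by linarith
  calc X = 2 / (r - 1) * ((r - 1) / 2 * X) := by field_simp
    _ ≤ 2 / (r - 1) * (1 / R + 2 * r ^ 2 / (r - 1) * E ^ (r - 1) * B) := by gcongr
    _ = _ := by field_simp; ring

set_option maxHeartbeats 2000000 in
/-- Lower bound for the time derivative of the truncated virial functional. -/
lemma lower {a b ax bx h F : ℝ → ℝ} {R r E C : ℝ} (hR : 1 ≤ R) (hr : 1 < r) (hE1 : E ≤ 1)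
    (hC : 0 ≤ C)
    (ha : ∀ x, HasDerivAt a (ax x) x) (hb : ∀ x, HasDerivAt b (bx x) x)
    (cax : Continuous ax) (cbx : Continuous bx) (ch : Continuous h) (cF : Continuous F)
    (a0 : a 0 = 0) (b0 : b 0 = 0)
    (hg : ∀ x, 0 ≤ x → a x ^ 2 + b x ^ 2 ≤ E)
    (hI : ∫ x in (0:ℝ)..R, ((a x ^ 2 + b x ^ 2) + (ax x ^ 2 + bx x ^ 2)) ≤ E)
    (hh : ∀ x, |h x| ≤ C * (a x ^ 2 + b x ^ 2) ^ (r - 1))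
    (hF : ∀ x, |F x| ≤ C * (a x ^ 2 + b x ^ 2) ^ r)
    (small : 2 * C * (4 * r ^ 2 / (r - 1) ^ 2 * E ^ (r - 1)) ≤ 1) :
    (∫ x in (0:ℝ)..R, exp (-x) * ((ax x - a x / 2) ^ 2 + (bx x - b x / 2) ^ 2))
      - (30 + 12 * C + 4 * C / (r - 1)) / R ≤
    ∫ x in (0:ℝ)..R, (φ1 R x * (2 * (ax x ^ 2 + bx x ^ 2) + h x * (a x ^ 2 + b x ^ 2) - F x)
          - 1 / 2 * φ3 R x * (a x ^ 2 + b x ^ 2)) := by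
  have ca : Continuous a := continuous_iff_continuousAt.2 fun x => (ha x).continuousAt
  have cb : Continuous b := continuous_iff_continuousAt.2 fun x => (hb x).continuousAt
  have hR0 : 0 < R := by linarith
  have hr1 : 0 < r - 1 := by linarith
  have cg : Continuous fun x => a x ^ 2 + b x ^ 2 := by fun_prop
  have cgr : Continuous fun x => (a x ^ 2 + b x ^ 2) ^ r := cg.rpow_const fun _ => Or.inr (by linarith)
  have cφ1 : Continuous (φ1 R) := continuous_iff_continuousAt.2 fun x => (φ1_deriv R x).continuousAt
  have cφ3 := φ3_cont R
  have hq := quad (R := R) ha hb cax cbx a0 b0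
  have hn := nonlin (R := R) hR hr hE1 ha hb cax cbx a0 b0 hg
  have pt : ∀ x ∈ Set.Icc 0 R,
      exp (-x) * (2 * (ax x ^ 2 + bx x ^ 2) - 1 / 2 * (a x ^ 2 + b x ^ 2))
      - 2 * C * (exp (-x) * (a x ^ 2 + b x ^ 2) ^ r)
      - (30 + 12 * C) / R * ((a x ^ 2 + b x ^ 2) + (ax x ^ 2 + bx x ^ 2)) ≤
      (φ1 R x * (2 * (ax x ^ 2 + bx x ^ 2) + h x * (a x ^ 2 + b x ^ 2) - F x)
          - 1 / 2 * φ3 R x * (a x ^ 2 + b x ^ 2)) := by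
    intro x hx
    obtain ⟨-, h1, h3⟩ := φ_bounds hR hx.1 hx.2
    have hgx := (hg x hx.1).trans hE1
    have hgn : 0 ≤ a x ^ 2 + b x ^ 2 := by positivity
    have hpow : (a x ^ 2 + b x ^ 2) ^ r = (a x ^ 2 + b x ^ 2) ^ (r - 1) * (a x ^ 2 + b x ^ 2) := by
      rcases hgn.eq_or_lt with h | h
      · rw [← h, Real.zero_rpow (by linarith : r ≠ 0)]; simp
      · rw [← Real.rpow_add_one h.ne']; ring_nf
    have hle : (a x ^ 2 + b x ^ 2) ^ r ≤ a x ^ 2 + b x ^ 2 := by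
      rw [hpow]
      have := Real.rpow_le_one hgn hgx hr1.le
      nlinarith
    have hHbd : |h x * (a x ^ 2 + b x ^ 2) - F x| ≤ 2 * C * (a x ^ 2 + b x ^ 2) ^ r := by
      refine (abs_sub _ _).trans ?_
      rw [abs_mul, abs_of_nonneg hgn]
      have := mul_le_mul_of_nonneg_right (hh x) hgn
      have h4 := hF x
      rw [hpow] at h4 ⊢
      linarith
    have hDn : 0 ≤ ax x ^ 2 + bx x ^ 2 := by positivity
    set g := a x ^ 2 + b x ^ 2
    set D := ax x ^ 2 + bx x ^ 2
    set H := h x * g - F x with hH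
    set Y := g ^ r
    have hY0 : 0 ≤ Y := Real.rpow_nonneg hgn _
    set d := 1 / R with hd
    have d0 : 0 < d := by positivity
    rw [show (6:ℝ) / R = 6 * d by rw [hd]; ring] at h1
    rw [show (36:ℝ) / R = 36 * d by rw [hd]; ring] at h3
    rw [show (30 + 12 * C) / R = (30 + 12 * C) * d by rw [hd]; ring,
      show 2 * D + h x * g - F x = 2 * D + H by rw [hH]; ring]
    have ex := exp_pos (-x)
    set e := exp (-x)
    obtain ⟨s, hs⟩ : ∃ s, s = φ1 R x - e := ⟨_, rfl⟩
    obtain ⟨k, hk⟩ : ∃ k, k = φ3 R x - e := ⟨_, rfl⟩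
    rw [← hs] at h1; rw [← hk] at h3
    rw [show φ1 R x = e + s by rw [hs]; ring, show φ3 R x = e + k by rw [hk]; ring]
    have b1 : |s * (2 * D + H)| ≤ 6 * d * (2 * D + 2 * C * g) := by
      rw [abs_mul]
      gcongr
      refine (abs_add_le _ _).trans ?_
      rw [abs_of_nonneg (by positivity : 0 ≤ 2 * D)]
      have : 2 * C * Y ≤ 2 * C * g := by gcongr
      linarith
    have b2 : |k * g| ≤ 36 * d * g := by
      rw [abs_mul, abs_of_nonneg hgn]; gcongr
    have b3 : |e * H| ≤ e * (2 * C * Y) := by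
      rw [abs_mul, abs_of_pos ex]; gcongr
    rw [abs_le] at b1 b2 b3
    have b4 : 0 ≤ d * (18 * D + 12 * C * D + 12 * g) := by positivity
    nlinarith [b1.1, b2.2, b3.1]
  have c1 : Continuous fun x => exp (-x) * (2 * (ax x ^ 2 + bx x ^ 2) - 1 / 2 * (a x ^ 2 + b x ^ 2)) := by
    fun_prop
  have c2 : Continuous fun x => 2 * C * (exp (-x) * (a x ^ 2 + b x ^ 2) ^ r) := by fun_prop
  have c3 : Continuous fun x =>
      (30 + 12 * C) / R * ((a x ^ 2 + b x ^ 2) + (ax x ^ 2 + bx x ^ 2)) := by fun_prop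
  have c4 : Continuous fun x =>
    (φ1 R x * (2 * (ax x ^ 2 + bx x ^ 2) + h x * (a x ^ 2 + b x ^ 2) - F x)
          - 1 / 2 * φ3 R x * (a x ^ 2 + b x ^ 2)) := by fun_prop
  have mono := intervalIntegral.integral_mono_on (μ := volume) hR0.le
    (((c1.sub c2).sub c3).intervalIntegrable _ _) (c4.intervalIntegrable _ _) pt
  simp only [Pi.sub_apply] at mono
  have c12 : Continuous fun x =>
    exp (-x) * (2 * (ax x ^ 2 + bx x ^ 2) - 1 / 2 * (a x ^ 2 + b x ^ 2))
      - 2 * C * (exp (-x) * (a x ^ 2 + b x ^ 2) ^ r) := c1.sub c2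
  rw [intervalIntegral.integral_sub (c12.intervalIntegrable _ _) (c3.intervalIntegrable _ _),
    intervalIntegral.integral_sub (c1.intervalIntegrable _ _) (c2.intervalIntegrable _ _),
    intervalIntegral.integral_const_mul, intervalIntegral.integral_const_mul] at mono
  refine le_trans ?_ mono
  have hB0 : 0 ≤ ∫ x in (0:ℝ)..R, exp (-x) * ((ax x - a x / 2) ^ 2 + (bx x - b x / 2) ^ 2) :=
    intervalIntegral.integral_nonneg hR0.le fun x _ => by positivity
  set X := ∫ x in (0:ℝ)..R, exp (-x) * (a x ^ 2 + b x ^ 2) ^ r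
  set B := ∫ x in (0:ℝ)..R, exp (-x) * ((ax x - a x / 2) ^ 2 + (bx x - b x / 2) ^ 2)
  have k1 : 2 * C * X ≤ 4 * C / (r - 1) / R + B := by
    calc 2 * C * X ≤ 2 * C * (2 / (r - 1) * (1 / R) + 4 * r ^ 2 / (r - 1) ^ 2 * E ^ (r - 1) * B) := by
          gcongr
      _ = 4 * C / (r - 1) / R + 2 * C * (4 * r ^ 2 / (r - 1) ^ 2 * E ^ (r - 1)) * B := by
          field_simp; ring
      _ ≤ _ := by nlinarith
  have k2 : (30 + 12 * C) / R * ∫ x in (0:ℝ)..R, ((a x ^ 2 + b x ^ 2) + (ax x ^ 2 + bx x ^ 2))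
      ≤ (30 + 12 * C) / R := by
    have : 0 ≤ (30 + 12 * C) / R := by positivity
    nlinarith
  rw [add_div]
  linarith

end OddNLS


namespace OddNLS

/-- Real form of the equation, with all needed partial derivatives. -/
structure RSol (f : ℝ → ℝ) (a b ax bx axx bxx at' bt axt bxt : ℝ → ℝ → ℝ) : Prop where
  a_x : ∀ t x, HasDerivAt (a t) (ax t x) x
  b_x : ∀ t x, HasDerivAt (b t) (bx t x) x
  ax_x : ∀ t x, HasDerivAt (ax t) (axx t x) x
  bx_x : ∀ t x, HasDerivAt (bx t) (bxx t x) x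
  at_x : ∀ t x, HasDerivAt (at' t) (axt t x) x
  bt_x : ∀ t x, HasDerivAt (bt t) (bxt t x) x
  a_t : ∀ t x, HasDerivAt (fun s => a s x) (at' t x) t
  b_t : ∀ t x, HasDerivAt (fun s => b s x) (bt t x) t
  ax_t : ∀ t x, HasDerivAt (fun s => ax s x) (axt t x) t
  bx_t : ∀ t x, HasDerivAt (fun s => bx s x) (bxt t x) t
  ca : Continuous (Function.uncurry a)
  cb : Continuous (Function.uncurry b)
  cax : Continuous (Function.uncurry ax)
  cbx : Continuous (Function.uncurry bx)
  caxx : Continuous (Function.uncurry axx)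
  cbxx : Continuous (Function.uncurry bxx)
  cat : Continuous (Function.uncurry at')
  cbt : Continuous (Function.uncurry bt)
  caxt : Continuous (Function.uncurry axt)
  cbxt : Continuous (Function.uncurry bxt)
  e1 : ∀ t x, - bt t x + axx t x = f (a t x ^ 2 + b t x ^ 2) * a t x
  e2 : ∀ t x, at' t x + bxx t x = f (a t x ^ 2 + b t x ^ 2) * b t x
  a0 : ∀ t, a t 0 = 0
  b0 : ∀ t, b t 0 = 0

lemma slice {k : ℝ → ℝ → ℝ} (h : Continuous (Function.uncurry k)) (t : ℝ) : Continuous (k t) :=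
  h.comp (by fun_prop : Continuous fun x : ℝ => (t, x))

section
variable {f : ℝ → ℝ} {a b ax bx axx bxx at' bt axt bxt : ℝ → ℝ → ℝ} {E : ℝ}

/-- Pointwise control from the energy, with a parameter. -/
lemma RSol.sup_le (S : RSol f a b ax bx axx bxx at' bt axt bxt)
    (hI : ∀ t R, 0 ≤ R →
      ∫ x in (0:ℝ)..R, ((a t x ^ 2 + b t x ^ 2) + (ax t x ^ 2 + bx t x ^ 2)) ≤ E)
    {κ : ℝ} (hκ : 0 < κ) (t x L : ℝ) (hx : 0 ≤ x) (hxL : x ≤ L) :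
    a t x ^ 2 + b t x ^ 2 ≤ κ * E + 1 / κ * ∫ y in (0:ℝ)..L, (a t y ^ 2 + b t y ^ 2) := by
  have ca := slice S.ca t; have cb := slice S.cb t
  have cax := slice S.cax t; have cbx := slice S.cbx t
  have hQ : ∀ x, HasDerivAt (fun x => a t x ^ 2 + b t x ^ 2)
      (2 * (a t x * ax t x + b t x * bx t x)) x := by
    intro x
    refine (((S.a_x t x).pow 2).add ((S.b_x t x).pow 2)).congr_deriv ?_
    push_cast; ring
  have c1 : Continuous fun x => 2 * (a t x * ax t x + b t x * bx t x) := by fun_prop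
  have c2 : Continuous fun x => κ * ((a t x ^ 2 + b t x ^ 2) + (ax t x ^ 2 + bx t x ^ 2)) := by
    fun_prop
  have cg : Continuous fun x => (a t x ^ 2 + b t x ^ 2) := by fun_prop
  have c3 : Continuous fun x => 1 / κ * (a t x ^ 2 + b t x ^ 2) := by fun_prop
  have key := intervalIntegral.integral_eq_sub_of_hasDerivAt (a := 0) (b := x)
    (fun x _ => hQ x) (c1.intervalIntegrable _ _)
  simp only [S.a0, S.b0] at key
  have mono := intervalIntegral.integral_mono_on (μ := volume) hx (c1.intervalIntegrable _ _)
    ((c2.add c3).intervalIntegrable _ _) (fun y _ => by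
      show 2 * (a t y * ax t y + b t y * bx t y) ≤
        κ * ((a t y ^ 2 + b t y ^ 2) + (ax t y ^ 2 + bx t y ^ 2)) + 1 / κ * (a t y ^ 2 + b t y ^ 2)
      have h1 : κ * ((a t y ^ 2 + b t y ^ 2) + (ax t y ^ 2 + bx t y ^ 2))
        + 1 / κ * (a t y ^ 2 + b t y ^ 2) - 2 * (a t y * ax t y + b t y * bx t y) =
        κ * (a t y ^ 2 + b t y ^ 2) + 1 / κ * ((κ * ax t y - a t y) ^ 2 + (κ * bx t y - b t y) ^ 2) := by
        field_simp; ring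
      have h2 : 0 ≤ κ * (a t y ^ 2 + b t y ^ 2)
        + 1 / κ * ((κ * ax t y - a t y) ^ 2 + (κ * bx t y - b t y) ^ 2) := by positivity
      linarith)
  simp only [Pi.add_apply] at mono
  rw [key, intervalIntegral.integral_add (c2.intervalIntegrable _ _) (c3.intervalIntegrable _ _),
    intervalIntegral.integral_const_mul, intervalIntegral.integral_const_mul] at mono
  have h3 : ∫ y in (0:ℝ)..x, (a t y ^ 2 + b t y ^ 2) ≤ ∫ y in (0:ℝ)..L, (a t y ^ 2 + b t y ^ 2) :=
    intervalIntegral.integral_mono_interval le_rfl hx hxL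
      (Eventually.of_forall fun y => by simp only [Pi.zero_apply]; positivity) (cg.intervalIntegrable _ _)
  have h4 := mul_le_mul_of_nonneg_left (hI t x hx) hκ.le
  have h5 := mul_le_mul_of_nonneg_left h3 (by positivity : 0 ≤ 1 / κ)
  norm_num at mono h5 ⊢
  linarith

lemma RSol.g_le (S : RSol f a b ax bx axx bxx at' bt axt bxt)
    (hI : ∀ t R, 0 ≤ R →
      ∫ x in (0:ℝ)..R, ((a t x ^ 2 + b t x ^ 2) + (ax t x ^ 2 + bx t x ^ 2)) ≤ E)
    (t x : ℝ) (hx : 0 ≤ x) : a t x ^ 2 + b t x ^ 2 ≤ E := by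
  have ca := slice S.ca t; have cb := slice S.cb t
  have cax := slice S.cax t; have cbx := slice S.cbx t
  have hQ : ∀ x, HasDerivAt (fun x => a t x ^ 2 + b t x ^ 2)
      (2 * (a t x * ax t x + b t x * bx t x)) x := by
    intro x
    refine (((S.a_x t x).pow 2).add ((S.b_x t x).pow 2)).congr_deriv ?_
    push_cast; ring
  have c1 : Continuous fun x => 2 * (a t x * ax t x + b t x * bx t x) := by fun_prop
  have c2 : Continuous fun x => ((a t x ^ 2 + b t x ^ 2) + (ax t x ^ 2 + bx t x ^ 2)) := by
    fun_prop
  have key := intervalIntegral.integral_eq_sub_of_hasDerivAt (a := 0) (b := x)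
    (fun x _ => hQ x) (c1.intervalIntegrable _ _)
  simp only [S.a0, S.b0] at key
  have mono := intervalIntegral.integral_mono_on (μ := volume) hx (c1.intervalIntegrable _ _)
    (c2.intervalIntegrable _ _) (fun y _ => by
      nlinarith [sq_nonneg (a t y - ax t y), sq_nonneg (b t y - bx t y)])
  have := hI t x hx
  rw [key] at mono
  norm_num at mono
  linarith

/-- local smoothing density -/
noncomputable def bL (a b ax bx : ℝ → ℝ → ℝ) (L t : ℝ) : ℝ :=
  ∫ x in (0:ℝ)..L, exp (-x) * ((ax t x - a t x / 2) ^ 2 + (bx t x - b t x / 2) ^ 2)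

lemma RSol.bL_cont (S : RSol f a b ax bx axx bxx at' bt axt bxt) (L : ℝ) :
    Continuous (bL a b ax bx L) := by
  have := S.ca; have := S.cb; have := S.cax; have := S.cbx
  apply intervalIntegral.continuous_parametric_intervalIntegral_of_continuous'
  simp only [Function.uncurry_def] at *
  fun_prop

lemma RSol.bL_nonneg (L t : ℝ) (hL : 0 ≤ L) : 0 ≤ bL a b ax bx L t :=
  intervalIntegral.integral_nonneg hL fun x _ => by positivity

lemma RSol.bL_mono (S : RSol f a b ax bx axx bxx at' bt axt bxt) {L R : ℝ} (t : ℝ) (hL : 0 ≤ L)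
    (hLR : L ≤ R) : bL a b ax bx L t ≤ bL a b ax bx R t := by
  have ca := slice S.ca t; have cb := slice S.cb t
  have cax := slice S.cax t; have cbx := slice S.cbx t
  refine intervalIntegral.integral_mono_interval le_rfl hL hLR
    (Eventually.of_forall fun y => by simp only [Pi.zero_apply]; positivity)
    (Continuous.intervalIntegrable ?_ _ _)
  fun_prop

lemma RSol.virial_deriv (S : RSol f a b ax bx axx bxx at' bt axt bxt) (R t : ℝ) :
    HasDerivAt (fun s => ∫ x in (0:ℝ)..R, φ0 R x * (a s x * bx s x - b s x * ax s x))
      (∫ x in (0:ℝ)..R, φ0 R x * (at' t x * bx t x + a t x * bxt t x - bt t x * ax t x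
        - b t x * axt t x)) t := by
  have h0 : Continuous (φ0 R) := continuous_iff_continuousAt.2 fun x => (φ0_deriv R x).continuousAt
  refine leibniz (fun s x => φ0 R x * (a s x * bx s x - b s x * ax s x))
    (fun t x => φ0 R x * (at' t x * bx t x + a t x * bxt t x - bt t x * ax t x
        - b t x * axt t x)) R ?_ ?_ ?_ t
  · intro s
    have ca := slice S.ca s; have cb := slice S.cb s
    have cax := slice S.cax s; have cbx := slice S.cbx s
    fun_prop
  · have := S.ca; have := S.cb; have := S.cax; have := S.cbx
    have := S.cat; have := S.cbt; have := S.caxt; have := S.cbxt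
    simp only [Function.uncurry_def] at *
    fun_prop
  · intro s x
    refine ((((S.a_t s x).mul (S.bx_t s x)).sub ((S.b_t s x).mul (S.ax_t s x))).const_mul
      (φ0 R x)).congr_deriv ?_
    ring

lemma RSol.virial_lower (S : RSol f a b ax bx axx bxx at' bt axt bxt) {C r : ℝ} (hr : 1 < r)
    (hC : 0 ≤ C) (hf : ∀ s : ℝ, 0 ≤ s → |f s| ≤ C * s ^ (r - 1)) (hE1 : E ≤ 1)
    (hI : ∀ t R, 0 ≤ R →
      ∫ x in (0:ℝ)..R, ((a t x ^ 2 + b t x ^ 2) + (ax t x ^ 2 + bx t x ^ 2)) ≤ E)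
    (small : 2 * C * (4 * r ^ 2 / (r - 1) ^ 2 * E ^ (r - 1)) ≤ 1) {R : ℝ} (hR : 1 ≤ R) (t : ℝ) :
    bL a b ax bx R t - (30 + 12 * C + 4 * C / (r - 1)) / R ≤
      ∫ x in (0:ℝ)..R, φ0 R x * (at' t x * bx t x + a t x * bxt t x - bt t x * ax t x
        - b t x * axt t x) := by
  have ca := slice S.ca t; have cb := slice S.cb t
  have cax := slice S.cax t; have cbx := slice S.cbx t
  have caxx := slice S.caxx t; have cbxx := slice S.cbxx t
  have cat := slice S.cat t; have cbt := slice S.cbt t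
  have ch : Continuous fun x => f (a t x ^ 2 + b t x ^ 2) :=
    h_cont hr hf ca cb (n1 := fun x => - bt t x + axx t x) (n2 := fun x => at' t x + bxx t x)
      (by fun_prop) (by fun_prop) (S.e1 t) (S.e2 t)
  have hgd : ∀ x, HasDerivAt (fun x => a t x ^ 2 + b t x ^ 2)
      (2 * a t x * ax t x + 2 * b t x * bx t x) x := by
    intro x
    refine (((S.a_x t x).pow 2).add ((S.b_x t x).pow 2)).congr_deriv ?_
    push_cast; ring
  have cgd : Continuous fun x => 2 * a t x * ax t x + 2 * b t x * bx t x := by fun_prop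
  have cint : Continuous fun x => f (a t x ^ 2 + b t x ^ 2) *
      (2 * a t x * ax t x + 2 * b t x * bx t x) := ch.mul cgd
  have hFd : ∀ x, HasDerivAt (fun x => ∫ y in (0:ℝ)..x, f (a t y ^ 2 + b t y ^ 2) *
      (2 * a t y * ax t y + 2 * b t y * bx t y)) (f (a t x ^ 2 + b t x ^ 2) *
      (2 * a t x * ax t x + 2 * b t x * bx t x)) x := fun x =>
    cint.integral_hasStrictDerivAt 0 x |>.hasDerivAt
  have hFb := F_bound hr hC hf hgd cgd (by simp [S.a0, S.b0]) (fun x => by positivity) ch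
  have hRne : R ≠ 0 := by linarith
  rw [flux (S.a_x t) (S.b_x t) (S.ax_x t) (S.bx_x t) (S.at_x t) (S.bt_x t) hFd (φ0_deriv R)
    (φ1_deriv R) (φ2_deriv R) (φ3_cont R) (slice S.caxt t) (slice S.cbxt t) ch (S.e1 t) (S.e2 t)
    (S.a0 t) (S.b0 t) (by simp [φ0]) (by simp [φ0, hRne]) (by simp [φ1, hRne]) (by simp [φ2, hRne])]
  exact lower hR hr hE1 hC (S.a_x t) (S.b_x t) cax cbx ch
    (continuous_iff_continuousAt.2 fun x => (hFd x).continuousAt) (S.a0 t) (S.b0 t)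
    (S.g_le hI t) (hI t R (by linarith)) (fun x => hf _ (by positivity)) hFb small

lemma RSol.virial_bound (S : RSol f a b ax bx axx bxx at' bt axt bxt) (hE1 : E ≤ 1)
    (hI : ∀ t R, 0 ≤ R →
      ∫ x in (0:ℝ)..R, ((a t x ^ 2 + b t x ^ 2) + (ax t x ^ 2 + bx t x ^ 2)) ≤ E)
    {R : ℝ} (hR : 1 ≤ R) (t : ℝ) :
    |∫ x in (0:ℝ)..R, φ0 R x * (a t x * bx t x - b t x * ax t x)| ≤ 1 := by
  have ca := slice S.ca t; have cb := slice S.cb t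
  have cax := slice S.cax t; have cbx := slice S.cbx t
  have h0 : Continuous (φ0 R) := continuous_iff_continuousAt.2 fun x => (φ0_deriv R x).continuousAt
  have hR0 : 0 ≤ R := by linarith
  refine (intervalIntegral.abs_integral_le_integral_abs hR0).trans
    (le_trans ?_ ((hI t R hR0).trans hE1))
  refine intervalIntegral.integral_mono_on hR0 (Continuous.intervalIntegrable (by fun_prop) _ _)
    (Continuous.intervalIntegrable (by fun_prop) _ _) fun x hx => ?_
  obtain ⟨h1, -, -⟩ := φ_bounds hR hx.1 hx.2
  rw [abs_mul]
  have h2 : |a t x * bx t x - b t x * ax t x| ≤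
      a t x ^ 2 + b t x ^ 2 + (ax t x ^ 2 + bx t x ^ 2) := by
    rw [abs_le]
    constructor <;> nlinarith [sq_nonneg (a t x - bx t x), sq_nonneg (b t x - ax t x),
      sq_nonneg (a t x + bx t x), sq_nonneg (b t x + ax t x)]
  have := abs_nonneg (a t x * bx t x - b t x * ax t x)
  nlinarith

lemma RSol.bL_integrable (S : RSol f a b ax bx axx bxx at' bt axt bxt) {C r : ℝ} (hr : 1 < r)
    (hC : 0 ≤ C) (hf : ∀ s : ℝ, 0 ≤ s → |f s| ≤ C * s ^ (r - 1)) (hE1 : E ≤ 1)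
    (hI : ∀ t R, 0 ≤ R →
      ∫ x in (0:ℝ)..R, ((a t x ^ 2 + b t x ^ 2) + (ax t x ^ 2 + bx t x ^ 2)) ≤ E)
    (small : 2 * C * (4 * r ^ 2 / (r - 1) ^ 2 * E ^ (r - 1)) ≤ 1) {L : ℝ} (hL : 0 ≤ L) :
    IntegrableOn (bL a b ax bx L) (Set.Ioi 0) := by
  have cb := S.bL_cont L
  refine integrableOn_Ioi_of_intervalIntegral_norm_bounded (l := atTop) (b := id) 2 0
    (fun i => (cb.integrableOn_Icc (a := 0) (b := i)).mono_set Set.Ioc_subset_Icc_self)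
    tendsto_id ?_
  filter_upwards [eventually_ge_atTop (0:ℝ)] with T hT
  simp only [id]
  have hnorm : ∀ t, ‖bL a b ax bx L t‖ = bL a b ax bx L t := fun t =>
    abs_of_nonneg (RSol.bL_nonneg L t hL)
  simp only [hnorm]
  set K := 30 + 12 * C + 4 * C / (r - 1)
  have hlim : Tendsto (fun R : ℝ => 2 + T * (K / R)) atTop (nhds (2 + T * 0)) :=
    ((tendsto_const_nhds.div_atTop tendsto_id).const_mul T).const_add 2
  rw [mul_zero, add_zero] at hlim
  refine ge_of_tendsto hlim ?_
  filter_upwards [eventually_ge_atTop (1:ℝ), eventually_ge_atTop L] with R hR hLR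
  have cder : Continuous fun t => ∫ x in (0:ℝ)..R, φ0 R x * (at' t x * bx t x + a t x * bxt t x
      - bt t x * ax t x - b t x * axt t x) := by
    have h0 : Continuous (φ0 R) :=
      continuous_iff_continuousAt.2 fun x => (φ0_deriv R x).continuousAt
    have := S.ca; have := S.cb; have := S.cax; have := S.cbx
    have := S.cat; have := S.cbt; have := S.caxt; have := S.cbxt
    apply intervalIntegral.continuous_parametric_intervalIntegral_of_continuous'
    simp only [Function.uncurry_def] at *
    fun_prop
  have ftc := intervalIntegral.integral_eq_sub_of_hasDerivAt (a := 0) (b := T)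
    (fun t _ => S.virial_deriv R t) (cder.intervalIntegrable _ _)
  have c0 : Continuous fun t => bL a b ax bx L t - K / R := cb.sub continuous_const
  have mono := intervalIntegral.integral_mono_on (μ := volume) hT (c0.intervalIntegrable _ _)
    (cder.intervalIntegrable _ _) (fun t _ =>
      (sub_le_sub_right (S.bL_mono t hL hLR) _).trans
        (S.virial_lower hr hC hf hE1 hI small hR t))
  rw [ftc, intervalIntegral.integral_sub (cb.intervalIntegrable _ _) intervalIntegrable_const,
    intervalIntegral.integral_const] at mono
  have b1 := abs_le.1 (S.virial_bound hE1 hI hR T)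
  have b2 := abs_le.1 (S.virial_bound hE1 hI hR 0)
  simp only [sub_zero, smul_eq_mul] at mono
  linarith [b1.2, b2.1]

/-- local H¹ norm controlled by the smoothing density -/
lemma RSol.local_le (S : RSol f a b ax bx axx bxx at' bt axt bxt) {L : ℝ} (hL : 0 ≤ L) (t : ℝ) :
    (∫ x in (0:ℝ)..L, ((a t x ^ 2 + b t x ^ 2) + (ax t x ^ 2 + bx t x ^ 2)))
      ≤ (L * (2 * exp (2 * L)) + 2 * exp L) * bL a b ax bx L t := by
  have ca := slice S.ca t; have cb := slice S.cb t
  have cax := slice S.cax t; have cbx := slice S.cbx t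
  have hpt : ∀ x ∈ Set.Icc 0 L, a t x ^ 2 + b t x ^ 2 ≤ exp (2 * L) * bL a b ax bx L t := by
    intro x hx
    have he : ∀ y : ℝ, HasDerivAt (fun y => exp (-(2 * y))) (-2 * exp (-(2 * y))) y := by
      intro y
      have := ((hasDerivAt_id y).const_mul (2:ℝ)).neg.exp
      refine this.congr_deriv ?_
      simp; ring
    have hQ : ∀ y, HasDerivAt (fun y => exp (-(2 * y)) * (a t y ^ 2 + b t y ^ 2))
      (-2 * exp (-(2 * y)) * (a t y ^ 2 + b t y ^ 2) +
        exp (-(2 * y)) * (2 * (a t y * ax t y + b t y * bx t y))) y := by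
      intro y
      refine ((he y).mul (((S.a_x t y).pow 2).add ((S.b_x t y).pow 2))).congr_deriv ?_
      simp only [Pi.add_apply, Pi.pow_apply]; push_cast; ring
    have c1 : Continuous fun y => (-2 * exp (-(2 * y)) * (a t y ^ 2 + b t y ^ 2) +
        exp (-(2 * y)) * (2 * (a t y * ax t y + b t y * bx t y))) := by fun_prop
    have c2 : Continuous fun y =>
      exp (-y) * ((ax t y - a t y / 2) ^ 2 + (bx t y - b t y / 2) ^ 2) := by fun_prop
    have key := intervalIntegral.integral_eq_sub_of_hasDerivAt (a := 0) (b := x)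
      (fun x _ => hQ x) (c1.intervalIntegrable _ _)
    simp only [S.a0, S.b0] at key
    have mono := intervalIntegral.integral_mono_on (μ := volume) hx.1 (c1.intervalIntegrable _ _)
      (c2.intervalIntegrable _ _) (fun y hy => by
        have e1 : exp (-(2 * y)) ≤ exp (-y) := exp_le_exp.2 (by linarith [hy.1])
        have e0 := exp_pos (-(2 * y))
        have q : -2 * (a t y ^ 2 + b t y ^ 2) + 2 * (a t y * ax t y + b t y * bx t y) ≤
            (ax t y - a t y / 2) ^ 2 + (bx t y - b t y / 2) ^ 2 := by
          nlinarith [sq_nonneg (ax t y - a t y / 2 - a t y), sq_nonneg (bx t y - b t y / 2 - b t y)]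
        have q0 : 0 ≤ (ax t y - a t y / 2) ^ 2 + (bx t y - b t y / 2) ^ 2 := by positivity
        calc _ = exp (-(2 * y)) * (-2 * (a t y ^ 2 + b t y ^ 2)
                + 2 * (a t y * ax t y + b t y * bx t y)) := by ring
          _ ≤ exp (-(2 * y)) * ((ax t y - a t y / 2) ^ 2 + (bx t y - b t y / 2) ^ 2) := by gcongr
          _ ≤ _ := by gcongr)
    rw [key] at mono
    have m2 := mono.trans (S.bL_mono t hx.1 hx.2)
    norm_num at m2
    have e3 : exp (2 * L) * exp (-(2 * x)) ≥ 1 := by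
      rw [← exp_add]; exact one_le_exp (by linarith [hx.2])
    have hg0 : 0 ≤ a t x ^ 2 + b t x ^ 2 := by positivity
    have := mul_le_mul_of_nonneg_left m2 (exp_pos (2 * L)).le
    nlinarith
  have c2 : Continuous fun y =>
      2 * exp L * (exp (-y) * ((ax t y - a t y / 2) ^ 2 + (bx t y - b t y / 2) ^ 2)) := by fun_prop
  have c1 : Continuous fun x => ((a t x ^ 2 + b t x ^ 2) + (ax t x ^ 2 + bx t x ^ 2)) := by fun_prop
  have c3 : Continuous fun _ : ℝ => 2 * (exp (2 * L) * bL a b ax bx L t) := continuous_const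
  have mono := intervalIntegral.integral_mono_on (μ := volume) hL (c1.intervalIntegrable _ _)
      ((c3.add c2).intervalIntegrable _ _) (fun y hy => by
        show _ ≤ 2 * (exp (2 * L) * bL a b ax bx L t) + 2 * exp L * (exp (-y) * ((ax t y - a t y / 2) ^ 2 + (bx t y - b t y / 2) ^ 2))
        have h1 := hpt y hy
        have e3 : 1 ≤ exp L * exp (-y) := by
          rw [← exp_add]; exact one_le_exp (by linarith [hy.2])
        have q0 : 0 ≤ (ax t y - a t y / 2) ^ 2 + (bx t y - b t y / 2) ^ 2 := by positivity
        have q1 := mul_le_mul_of_nonneg_right e3 q0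
        have q2 : ax t y ^ 2 + bx t y ^ 2 ≤ 2 * ((ax t y - a t y / 2) ^ 2 + (bx t y - b t y / 2) ^ 2)
            + (a t y ^ 2 + b t y ^ 2) := by
          nlinarith [sq_nonneg (ax t y - a t y / 2 - a t y / 2), sq_nonneg (bx t y - b t y / 2 - b t y / 2)]
        linarith)
  simp only [Pi.add_apply] at mono
  rw [intervalIntegral.integral_add (c3.intervalIntegrable _ _) (c2.intervalIntegrable _ _),
    intervalIntegral.integral_const, intervalIntegral.integral_const_mul] at mono
  refine mono.trans (le_of_eq ?_)
  simp only [bL, smul_eq_mul]; ring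

/-- The localized mass tends to zero. -/
lemma RSol.mass_tendsto (S : RSol f a b ax bx axx bxx at' bt axt bxt) {C r : ℝ} (hr : 1 < r)
    (hC : 0 ≤ C) (hf : ∀ s : ℝ, 0 ≤ s → |f s| ≤ C * s ^ (r - 1)) (hE1 : E ≤ 1)
    (hI : ∀ t R, 0 ≤ R →
      ∫ x in (0:ℝ)..R, ((a t x ^ 2 + b t x ^ 2) + (ax t x ^ 2 + bx t x ^ 2)) ≤ E)
    (small : 2 * C * (4 * r ^ 2 / (r - 1) ^ 2 * E ^ (r - 1)) ≤ 1) {L : ℝ} (hL : 0 ≤ L) :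
    Tendsto (fun t => ∫ x in (0:ℝ)..L, (L - x) * (a t x ^ 2 + b t x ^ 2)) atTop (nhds 0) := by
  have hB := S.bL_integrable hr hC hf hE1 hI small hL
  have jc : Continuous fun t => ∫ x in (0:ℝ)..L, (L - x) * (a t x ^ 2 + b t x ^ 2) := by
    have := S.ca; have := S.cb
    apply intervalIntegral.continuous_parametric_intervalIntegral_of_continuous'
    simp only [Function.uncurry_def] at *
    fun_prop
  have jc' : Continuous fun t => ∫ x in (0:ℝ)..L, (-2) * (a t x * bx t x - b t x * ax t x) := by
    have := S.ca; have := S.cb; have := S.cax; have := S.cbx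
    apply intervalIntegral.continuous_parametric_intervalIntegral_of_continuous'
    simp only [Function.uncurry_def] at *
    fun_prop
  set M := L * (2 * exp (2 * L)) + 2 * exp L
  refine tendsto_zero_of_hasDerivAt_of_integrableOn_Ioi (a := 0)
    (f' := fun t => ∫ x in (0:ℝ)..L, (-2) * (a t x * bx t x - b t x * ax t x)) ?_ ?_ ?_
  · intro t _
    have ca := slice S.ca t; have cb := slice S.cb t
    have cax := slice S.cax t; have cbx := slice S.cbx t
    have caxx := slice S.caxx t; have cbxx := slice S.cbxx t
    have cat := slice S.cat t; have cbt := slice S.cbt t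
    have h := leibniz (fun t x => (L - x) * (a t x ^ 2 + b t x ^ 2))
      (fun t x => (L - x) * (2 * (a t x * at' t x + b t x * bt t x))) L
      (fun t => by
        have ca := slice S.ca t; have cb := slice S.cb t
        fun_prop)
      (by
        have := S.ca; have := S.cb; have := S.cat; have := S.cbt
        simp only [Function.uncurry_def] at *
        fun_prop)
      (fun t x => by
        refine ((((S.a_t t x).pow 2).add ((S.b_t t x).pow 2)).const_mul (L - x)).congr_deriv ?_
        push_cast; ring) t
    refine h.congr_deriv ?_
    have hQ : ∀ x, HasDerivAt (fun x => (L - x) * ((-2) * (a t x * bx t x - b t x * ax t x)))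
        ((L - x) * (2 * (a t x * at' t x + b t x * bt t x))
          - (-2) * (a t x * bx t x - b t x * ax t x)) x := by
      intro x
      refine (((hasDerivAt_id x).const_sub L).mul ((((S.a_x t x).mul (S.bx_x t x)).sub
        ((S.b_x t x).mul (S.ax_x t x))).const_mul (-2))).congr_deriv ?_
      have E1 : axx t x = f (a t x ^ 2 + b t x ^ 2) * a t x + bt t x := by linarith [S.e1 t x]
      have E2 : bxx t x = f (a t x ^ 2 + b t x ^ 2) * b t x - at' t x := by linarith [S.e2 t x]
      simp only [E1, E2, Pi.mul_apply, Pi.sub_apply, id]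
      ring
    have i1 : Continuous fun x => (L - x) * (2 * (a t x * at' t x + b t x * bt t x)) := by fun_prop
    have i2 : Continuous fun x => (-2) * (a t x * bx t x - b t x * ax t x) := by fun_prop
    have := intervalIntegral.integral_eq_sub_of_hasDerivAt (a := 0) (b := L)
      (fun x _ => hQ x) ((i1.sub i2).intervalIntegrable _ _)
    rw [intervalIntegral.integral_sub (i1.intervalIntegrable _ _) (i2.intervalIntegrable _ _)] at this
    simp only [S.a0, S.b0, sub_self, zero_mul, mul_zero] at this
    linarith
  · refine Integrable.mono' (hB.const_mul M) jc'.aestronglyMeasurable (Eventually.of_forall fun t => ?_)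
    have ca := slice S.ca t; have cb := slice S.cb t
    have cax := slice S.cax t; have cbx := slice S.cbx t
    refine le_trans ?_ (S.local_le hL t)
    rw [Real.norm_eq_abs]
    refine (intervalIntegral.abs_integral_le_integral_abs hL).trans ?_
    refine intervalIntegral.integral_mono_on hL (Continuous.intervalIntegrable (by fun_prop) _ _)
      (Continuous.intervalIntegrable (by fun_prop) _ _) fun x hx => ?_
    rw [abs_le]
    constructor <;> nlinarith [sq_nonneg (a t x - bx t x), sq_nonneg (b t x - ax t x),
      sq_nonneg (a t x + bx t x), sq_nonneg (b t x + ax t x)]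
  · refine Integrable.mono' (hB.const_mul (L * M)) jc.aestronglyMeasurable
      (Eventually.of_forall fun t => ?_)
    have ca := slice S.ca t; have cb := slice S.cb t
    have cax := slice S.cax t; have cbx := slice S.cbx t
    have h1 := mul_le_mul_of_nonneg_left (S.local_le hL t) hL
    rw [mul_assoc]
    refine le_trans ?_ h1
    rw [Real.norm_eq_abs, ← intervalIntegral.integral_const_mul]
    refine (intervalIntegral.abs_integral_le_integral_abs hL).trans ?_
    refine intervalIntegral.integral_mono_on hL (Continuous.intervalIntegrable (by fun_prop) _ _)
      (Continuous.intervalIntegrable (by fun_prop) _ _) fun x hx => ?_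
    have hg0 : 0 ≤ a t x ^ 2 + b t x ^ 2 := by positivity
    have hD0 : 0 ≤ ax t x ^ 2 + bx t x ^ 2 := by positivity
    have hLx : 0 ≤ L - x := by linarith [hx.2]
    rw [abs_of_nonneg (mul_nonneg hLx hg0)]
    nlinarith [mul_nonneg hx.1 hg0, mul_nonneg hL hD0]

/-- Uniform local decay. -/
lemma RSol.decay (S : RSol f a b ax bx axx bxx at' bt axt bxt) {C r : ℝ} (hr : 1 < r)
    (hC : 0 ≤ C) (hf : ∀ s : ℝ, 0 ≤ s → |f s| ≤ C * s ^ (r - 1)) (hE1 : E ≤ 1)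
    (hI : ∀ t R, 0 ≤ R →
      ∫ x in (0:ℝ)..R, ((a t x ^ 2 + b t x ^ 2) + (ax t x ^ 2 + bx t x ^ 2)) ≤ E)
    (small : 2 * C * (4 * r ^ 2 / (r - 1) ^ 2 * E ^ (r - 1)) ≤ 1) {L : ℝ} (hL : 0 ≤ L)
    {δ : ℝ} (hδ : 0 < δ) :
    ∀ᶠ t in atTop, ∀ x ∈ Set.Icc 0 L, a t x ^ 2 + b t x ^ 2 ≤ δ := by
  have hm := S.mass_tendsto hr hC hf hE1 hI small (L := L + 1) (by linarith)
  have hδ2 : 0 < (δ / 2) * (δ / 2) := by positivity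
  filter_upwards [hm.eventually_lt_const hδ2] with t ht x hx
  have ca := slice S.ca t; have cb := slice S.cb t
  have h1 := S.sup_le hI (half_pos hδ) t x L hx.1 hx.2
  have h2 : ∫ y in (0:ℝ)..L, (a t y ^ 2 + b t y ^ 2) ≤
      ∫ x in (0:ℝ)..(L + 1), (L + 1 - x) * (a t x ^ 2 + b t x ^ 2) := by
    have c2 : Continuous fun x => (L + 1 - x) * (a t x ^ 2 + b t x ^ 2) := by fun_prop
    calc _ ≤ ∫ x in (0:ℝ)..L, (L + 1 - x) * (a t x ^ 2 + b t x ^ 2) := by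
          refine intervalIntegral.integral_mono_on hL (Continuous.intervalIntegrable (by fun_prop) _ _)
            (c2.intervalIntegrable _ _) fun y hy => ?_
          have hg0 : 0 ≤ a t y ^ 2 + b t y ^ 2 := by positivity
          nlinarith [hy.2]
      _ ≤ _ := by
          rw [← intervalIntegral.integral_add_adjacent_intervals (b := L) (c := L + 1)
            (c2.intervalIntegrable _ _) (c2.intervalIntegrable _ _)]
          have : 0 ≤ ∫ x in L..(L + 1), (L + 1 - x) * (a t x ^ 2 + b t x ^ 2) :=
            intervalIntegral.integral_nonneg (by linarith) fun y hy =>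
              mul_nonneg (by linarith [hy.2]) (by positivity)
          linarith
  have h3 : 1 / (δ / 2) * ∫ y in (0:ℝ)..L, (a t y ^ 2 + b t y ^ 2) ≤ δ / 2 := by
    calc _ ≤ 1 / (δ / 2) * ((δ / 2) * (δ / 2)) := by
          gcongr; exact h2.trans ht.le
      _ = δ / 2 := by field_simp
  nlinarith

end

end OddNLS


namespace OddNLS

lemma pd_x {V : ℝ × ℝ → ℂ} (hV : Differentiable ℝ V) (t x : ℝ) :
    HasDerivAt (fun y => V (t, y)) (fderiv ℝ V (t, x) (0, 1)) x := by
  have h : HasDerivAt (fun y : ℝ => (t, y)) ((0:ℝ), (1:ℝ)) x :=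
    (hasDerivAt_const x t).prodMk (hasDerivAt_id x)
  exact (hV (t, x)).hasFDerivAt.comp_hasDerivAt x h

lemma pd_t {V : ℝ × ℝ → ℂ} (hV : Differentiable ℝ V) (t x : ℝ) :
    HasDerivAt (fun s => V (s, x)) (fderiv ℝ V (t, x) (1, 0)) t := by
  have h : HasDerivAt (fun s : ℝ => (s, x)) ((1:ℝ), (0:ℝ)) t :=
    (hasDerivAt_id t).prodMk (hasDerivAt_const t x)
  exact (hV (t, x)).hasFDerivAt.comp_hasDerivAt t h

lemma dd {V : ℝ × ℝ → ℂ} (hV : ContDiff ℝ (⊤ : ℕ∞) V) (v : ℝ × ℝ) :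
    ContDiff ℝ (⊤ : ℕ∞) (fun z => fderiv ℝ V z v) :=
  (hV.fderiv_right (m := (⊤ : ℕ∞)) (by exact le_rfl)).clm_apply contDiff_const

lemma symm2 {V : ℝ × ℝ → ℂ} (hV : ContDiff ℝ (⊤ : ℕ∞) V) (v w z : ℝ × ℝ) :
    fderiv ℝ (fun z => fderiv ℝ V z v) z w = fderiv ℝ (fun z => fderiv ℝ V z w) z v := by
  have hs : IsSymmSndFDerivAt ℝ V z :=
    hV.contDiffAt.isSymmSndFDerivAt (by
      rw [minSmoothness_of_isRCLikeNormedField]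
      exact WithTop.coe_le_coe.2 (le_top : (2 : ℕ∞) ≤ ⊤))
  have hd : DifferentiableAt ℝ (fderiv ℝ V) z :=
    ((hV.fderiv_right (m := (⊤ : ℕ∞)) (by exact le_rfl)).differentiable (by simp)) z
  have k (v w : ℝ × ℝ) : fderiv ℝ (fun z => fderiv ℝ V z v) z w = fderiv ℝ (fderiv ℝ V) z w v := by
    rw [fderiv_clm_apply hd (differentiableAt_const v)]
    simp
  rw [k, k]
  exact hs _ _

lemma hre {F : ℝ → ℂ} {F' : ℂ} {x : ℝ} (h : HasDerivAt F F' x) :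
    HasDerivAt (fun y => (F y).re) F'.re x :=
  Complex.reCLM.hasFDerivAt.comp_hasDerivAt x h

lemma him {F : ℝ → ℂ} {F' : ℂ} {x : ℝ} (h : HasDerivAt F F' x) :
    HasDerivAt (fun y => (F y).im) F'.im x :=
  Complex.imCLM.hasFDerivAt.comp_hasDerivAt x h

lemma nsq (z : ℂ) : ‖z‖ ^ 2 = z.re ^ 2 + z.im ^ 2 := by
  rw [← Complex.normSq_eq_norm_sq, Complex.normSq_apply]; ring

lemma exists_RSol {f : ℝ → ℝ} {u : ℝ → ℝ → ℂ} (hu : ContDiff ℝ (⊤ : ℕ∞) (Function.uncurry u))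
    (heq : ∀ t x : ℝ, Complex.I * deriv (fun s => u s x) t + deriv (deriv (u t)) x
          = (f (‖u t x‖ ^ 2) : ℂ) * u t x)
    (hodd : ∀ t x : ℝ, u t (-x) = - u t x) :
    ∃ axx bxx at' bt axt bxt : ℝ → ℝ → ℝ,
      RSol f (fun t x => (u t x).re) (fun t x => (u t x).im)
        (fun t x => (deriv (u t) x).re) (fun t x => (deriv (u t) x).im)
        axx bxx at' bt axt bxt := by
  set U := Function.uncurry u with hU
  have dU : Differentiable ℝ U := hu.differentiable (by simp)
  set Ux : ℝ × ℝ → ℂ := fun z => fderiv ℝ U z (0, 1) with hUx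
  set Ut : ℝ × ℝ → ℂ := fun z => fderiv ℝ U z (1, 0) with hUt
  have sUx : ContDiff ℝ (⊤ : ℕ∞) Ux := dd hu _
  have sUt : ContDiff ℝ (⊤ : ℕ∞) Ut := dd hu _
  have dUx : Differentiable ℝ Ux := sUx.differentiable (by simp)
  have dUt : Differentiable ℝ Ut := sUt.differentiable (by simp)
  set Uxx : ℝ × ℝ → ℂ := fun z => fderiv ℝ Ux z (0, 1) with hUxx
  set Uxt : ℝ × ℝ → ℂ := fun z => fderiv ℝ Ux z (1, 0) with hUxt
  have cU := hu.continuous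
  have cUx := sUx.continuous
  have cUt := sUt.continuous
  have cUxx : Continuous Uxx := (dd sUx _).continuous
  have cUxt : Continuous Uxt := (dd sUx _).continuous
  have u_x : ∀ t x, HasDerivAt (u t) (Ux (t, x)) x := fun t x => pd_x dU t x
  have u_t : ∀ t x, HasDerivAt (fun s => u s x) (Ut (t, x)) t := fun t x => pd_t dU t x
  have du : ∀ t, deriv (u t) = fun x => Ux (t, x) := fun t => funext fun x => (u_x t x).deriv
  have ux_x : ∀ t x, HasDerivAt (fun y => Ux (t, y)) (Uxx (t, x)) x := fun t x => pd_x dUx t x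
  have ux_t : ∀ t x, HasDerivAt (fun s => Ux (s, x)) (Uxt (t, x)) t := fun t x => pd_t dUx t x
  have ut_x : ∀ t x, HasDerivAt (fun y => Ut (t, y)) (Uxt (t, x)) x := fun t x => by
    have := pd_x dUt t x
    rwa [hUt, symm2 hu] at this
  have heq' : ∀ t x, Complex.I * Ut (t, x) + Uxx (t, x) = (f (‖u t x‖ ^ 2) : ℂ) * u t x := by
    intro t x
    have := heq t x
    rwa [du t, (u_t t x).deriv, (ux_x t x).deriv] at this
  have u0 : ∀ t, u t 0 = 0 := by
    intro t
    have := hodd t 0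
    rw [neg_zero] at this
    exact self_eq_neg.1 this
  have cre : ∀ {V : ℝ × ℝ → ℂ}, Continuous V →
      Continuous (Function.uncurry fun t x => (V (t, x)).re) := fun h =>
    Complex.continuous_re.comp h
  have cim : ∀ {V : ℝ × ℝ → ℂ}, Continuous V →
      Continuous (Function.uncurry fun t x => (V (t, x)).im) := fun h =>
    Complex.continuous_im.comp h
  simp only [du]
  refine ⟨fun t x => (Uxx (t, x)).re, fun t x => (Uxx (t, x)).im, fun t x => (Ut (t, x)).re,
    fun t x => (Ut (t, x)).im, fun t x => (Uxt (t, x)).re, fun t x => (Uxt (t, x)).im, ?_⟩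
  constructor
  · exact fun t x => hre (u_x t x)
  · exact fun t x => him (u_x t x)
  · exact fun t x => hre (ux_x t x)
  · exact fun t x => him (ux_x t x)
  · exact fun t x => hre (ut_x t x)
  · exact fun t x => him (ut_x t x)
  · exact fun t x => hre (u_t t x)
  · exact fun t x => him (u_t t x)
  · exact fun t x => hre (ux_t t x)
  · exact fun t x => him (ux_t t x)
  · exact cre cU
  · exact cim cU
  · exact cre cUx
  · exact cim cUx
  · exact cre cUxx
  · exact cim cUxx
  · exact cre cUt
  · exact cim cUt
  · exact cre cUxt
  · exact cim cUxt
  · intro t x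
    have := congrArg Complex.re (heq' t x)
    rw [nsq] at this
    simpa using this
  · intro t x
    have := congrArg Complex.im (heq' t x)
    rw [nsq] at this
    simpa using this
  · intro t; simp [u0]
  · intro t; simp [u0]

lemma energy {u : ℝ → ℝ → ℂ} {E : ℝ}
    (hS : ∀ t : ℝ, ∃ g : SchwartzMap ℝ ℂ, ∀ x : ℝ, u t x = g x)
    (hE : ∀ t : ℝ, (∫ x : ℝ, ‖u t x‖ ^ 2) + (∫ x : ℝ, ‖deriv (u t) x‖ ^ 2) ≤ E)
    (t R : ℝ) (hR : 0 ≤ R) :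
    ∫ x in (0:ℝ)..R, (((u t x).re ^ 2 + (u t x).im ^ 2)
      + ((deriv (u t) x).re ^ 2 + (deriv (u t) x).im ^ 2)) ≤ E := by
  obtain ⟨g, hg⟩ := hS t
  have hug : u t = g := funext hg
  have sq (k : SchwartzMap ℝ ℂ) : Integrable fun x => ‖k x‖ ^ 2 :=
    (memLp_two_iff_integrable_sq_norm k.continuous.aestronglyMeasurable).1 (k.memLp 2)
  have i1 : Integrable fun x => ‖u t x‖ ^ 2 := by rw [hug]; exact sq g
  have i2 : Integrable fun x => ‖deriv (u t) x‖ ^ 2 := by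
    rw [hug]; exact sq (SchwartzMap.derivCLM ℝ ℂ g)
  simp only [← nsq]
  rw [intervalIntegral.integral_of_le hR]
  refine (setIntegral_le_integral (i1.add i2) (Eventually.of_forall fun x => ?_)).trans ?_
  · simp only [Pi.zero_apply, Pi.add_apply]; positivity
  · have := hE t
    rwa [← integral_add i1 i2] at this

end OddNLS

/-- Theorem 1.1 (NLS without potential): decay of small odd solutions on compact sets. -/
theorem decay_small_odd_NLS
    (p C : ℝ) (hp1 : 1 < p) (hp5 : p < 5)
    (f : ℝ → ℝ) (hf : ∀ s : ℝ, 0 ≤ s → |f s| ≤ C * s ^ ((p - 1) / 2)) :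
    ∃ ε > 0, ∀ u : ℝ → ℝ → ℂ,
      ContDiff ℝ (⊤ : ℕ∞) (Function.uncurry u) →
      (∀ t x : ℝ, Complex.I * deriv (fun s => u s x) t + deriv (deriv (u t)) x
          = (f (‖u t x‖ ^ 2) : ℂ) * u t x) →
      (∀ t x : ℝ, u t (-x) = - u t x) →
      (∀ t : ℝ, ∃ g : SchwartzMap ℝ ℂ, ∀ x : ℝ, u t x = g x) →
      (∀ t : ℝ, (∫ x : ℝ, ‖u t x‖ ^ 2) + (∫ x : ℝ, ‖deriv (u t) x‖ ^ 2) ≤ ε ^ 2) →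
      ∀ I : Set ℝ, I.OrdConnected → Bornology.IsBounded I →
        Tendsto (fun t : ℝ =>
            Real.sqrt (∫ x in I, ‖u t x‖ ^ 2) + (⨆ x ∈ I, ‖u t x‖))
          atTop (nhds 0) := by
  obtain ⟨r, hrdef⟩ : ∃ r, r = (p + 1) / 2 := ⟨_, rfl⟩
  have hr : 1 < r := by rw [hrdef]; linarith
  have hf' : ∀ s : ℝ, 0 ≤ s → |f s| ≤ C * s ^ (r - 1) := by
    intro s hs
    have := hf s hs
    rwa [show (p - 1) / 2 = r - 1 by rw [hrdef]; ring] at this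
  have hC : 0 ≤ C := by
    have := (abs_nonneg _).trans (hf 1 zero_le_one)
    simpa using this
  -- choice of ε
  obtain ⟨ε, hε0, hε1, small⟩ : ∃ ε : ℝ, 0 < ε ∧ ε ^ 2 ≤ 1 ∧
      2 * C * (4 * r ^ 2 / (r - 1) ^ 2 * (ε ^ 2) ^ (r - 1)) ≤ 1 := by
    have hc : ContinuousAt (fun ε : ℝ => 2 * C * (4 * r ^ 2 / (r - 1) ^ 2 * (ε ^ 2) ^ (r - 1))) 0 := by
      have : Continuous fun ε : ℝ => (ε ^ 2) ^ (r - 1) :=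
        (continuous_pow 2).rpow_const fun _ => Or.inr (by linarith)
      exact (continuous_const.mul (continuous_const.mul this)).continuousAt
    have h0 : (2 * C * (4 * r ^ 2 / (r - 1) ^ 2 * ((0:ℝ) ^ 2) ^ (r - 1))) < 1 := by
      rw [zero_pow two_ne_zero, Real.zero_rpow (by linarith)]; simp
    have h1 := (hc.eventually_lt_const h0).filter_mono (nhdsWithin_le_nhds (s := Set.Ioi 0))
    have h2 : ∀ᶠ ε : ℝ in nhdsWithin 0 (Set.Ioi 0), ε ∈ Set.Ioo (0:ℝ) 1 :=
      Ioo_mem_nhdsGT one_pos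
    obtain ⟨ε, ha, hb⟩ := (h1.and h2).exists
    exact ⟨ε, hb.1, by nlinarith [hb.1, hb.2], ha.le⟩
  refine ⟨ε, hε0, ?_⟩
  intro u hu heq hodd hS hE I hIo hIb
  obtain ⟨axx, bxx, at', bt, axt, bxt, S⟩ := OddNLS.exists_RSol hu heq hodd
  have hI := OddNLS.energy hS hE
  obtain ⟨L, hL0, hIL⟩ : ∃ L : ℝ, 0 < L ∧ I ⊆ Set.Icc (-L) L := by
    obtain ⟨M, hM⟩ := hIb.subset_closedBall 0
    refine ⟨max M 1, by positivity, fun x hx => ?_⟩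
    have := hM hx
    rw [Real.closedBall_eq_Icc] at this
    have h1 := le_max_left M 1
    exact ⟨by linarith [this.1], by linarith [this.2]⟩
  have unif : ∀ δ > 0, ∀ᶠ t in atTop, ∀ x ∈ Set.Icc (-L) L, ‖u t x‖ ≤ δ := by
    intro δ hδ
    filter_upwards [S.decay hr hC hf' hε1 hI small hL0.le (pow_pos hδ 2)] with t ht
    have pos : ∀ x ∈ Set.Icc 0 L, ‖u t x‖ ≤ δ := by
      intro x hx
      have := ht x hx
      rw [← OddNLS.nsq] at this
      exact (sq_le_sq₀ (norm_nonneg _) hδ.le).1 this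
    intro x hx
    rcases le_total 0 x with h | h
    · exact pos x ⟨h, hx.2⟩
    · have := pos (-x) ⟨by linarith, by linarith [hx.1]⟩
      rwa [hodd, norm_neg] at this
  have bd : ∀ δ > 0, ∀ᶠ t in atTop,
      Real.sqrt (∫ x in I, ‖u t x‖ ^ 2) + (⨆ x ∈ I, ‖u t x‖) ≤ (Real.sqrt (2 * L) + 1) * δ := by
    intro δ hδ
    filter_upwards [unif δ hδ] with t ht
    have h1 : ∫ x in I, ‖u t x‖ ^ 2 ≤ δ ^ 2 * (2 * L) := by
      have hvol : volume I ≤ ENNReal.ofReal (2 * L) := by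
        refine (measure_mono hIL).trans (le_of_eq ?_)
        rw [Real.volume_Icc]; congr 1; ring
      have hfin : volume I < ⊤ := hvol.trans_lt ENNReal.ofReal_lt_top
      have := norm_setIntegral_le_of_norm_le_const (f := fun x => ‖u t x‖ ^ 2) (C := δ ^ 2) hfin
        (fun x hx => by
          rw [Real.norm_eq_abs, abs_of_nonneg (by positivity)]
          have := ht x (hIL hx)
          gcongr)
      refine (le_abs_self _).trans (this.trans ?_)
      gcongr
      exact ENNReal.toReal_le_of_le_ofReal (by positivity) hvol
    have h2 : Real.sqrt (∫ x in I, ‖u t x‖ ^ 2) ≤ Real.sqrt (2 * L) * δ := by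
      refine (Real.sqrt_le_sqrt h1).trans (le_of_eq ?_)
      rw [Real.sqrt_mul (by positivity), Real.sqrt_sq hδ.le, mul_comm]
    have h3 : (⨆ x ∈ I, ‖u t x‖) ≤ δ :=
      Real.iSup_le (fun x => Real.iSup_le (fun hx => ht x (hIL hx)) hδ.le) hδ.le
    linarith
  rw [Metric.tendsto_nhds]
  intro η hη
  have hs : 0 < Real.sqrt (2 * L) + 1 := by positivity
  filter_upwards [bd (η / 2 / (Real.sqrt (2 * L) + 1)) (by positivity)] with t ht
  have hn : 0 ≤ Real.sqrt (∫ x in I, ‖u t x‖ ^ 2) + (⨆ x ∈ I, ‖u t x‖) :=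
    add_nonneg (Real.sqrt_nonneg _)
      (Real.iSup_nonneg fun x => Real.iSup_nonneg fun _ => norm_nonneg _)
  rw [Real.dist_0_eq_abs, abs_of_nonneg hn]
  have : (Real.sqrt (2 * L) + 1) * (η / 2 / (Real.sqrt (2 * L) + 1)) = η / 2 := by field_simp
  linarith
end

section
/- Let ε̃ ∈ ℝ, ε̃ ≠ 0. There exists ε > 0 such that: if u : ℝ × ℝ → ℂ is a global solution of i∂ₜu + ∂ₓₓu = |u|²u + ε̃|u|⁴u which is smooth, odd in x, with u(t,·) in the Schwartz class in x for each t, and satisfying sup_{t∈ℝ} (‖u(t,·)‖_{L²(ℝ)}² + ‖∂ₓu(t,·)‖_{L²(ℝ)}²) ≤ ε², then for every bounded interval I ⊂ ℝ one has lim_{t→∞} ( ‖u(t,·)‖_{L²(I)} + sup_{x∈I}|u(t,x)| ) = 0. -/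
open MeasureTheory Real Filter

noncomputable def pdx (F : ℝ → ℝ → ℝ) (t x : ℝ) : ℝ := fderiv ℝ (Function.uncurry F) (t, x) (0, 1)
noncomputable def pdt (F : ℝ → ℝ → ℝ) (t x : ℝ) : ℝ := fderiv ℝ (Function.uncurry F) (t, x) (1, 0)

abbrev Smooth2 (F : ℝ → ℝ → ℝ) : Prop := ContDiff ℝ (⊤ : ℕ∞) (Function.uncurry F)

lemma Smooth2.pdx {F : ℝ → ℝ → ℝ} (h : Smooth2 F) : Smooth2 (pdx F) := by
  have : ContDiff ℝ (⊤ : ℕ∞) (fderiv ℝ (Function.uncurry F)) := h.fderiv_right (by simp)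
  exact this.clm_apply contDiff_const

lemma Smooth2.hx {F : ℝ → ℝ → ℝ} (h : Smooth2 F) (t x : ℝ) : HasDerivAt (F t) (_root_.pdx F t x) x := by
  have h1 : HasFDerivAt (Function.uncurry F) (fderiv ℝ (Function.uncurry F) (t, x)) (t, x) :=
    (h.differentiable (by simp) _).hasFDerivAt
  have h2 : HasDerivAt (fun x : ℝ => (t, x)) ((0 : ℝ), (1 : ℝ)) x :=
    (hasDerivAt_const x t).prodMk (hasDerivAt_id x)
  exact h1.comp_hasDerivAt x h2

lemma Smooth2.ht {F : ℝ → ℝ → ℝ} (h : Smooth2 F) (t x : ℝ) :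
    HasDerivAt (fun s => F s x) (pdt F t x) t := by
  have h1 : HasFDerivAt (Function.uncurry F) (fderiv ℝ (Function.uncurry F) (t, x)) (t, x) :=
    (h.differentiable (by simp) _).hasFDerivAt
  have h2 : HasDerivAt (fun s : ℝ => (s, x)) ((1 : ℝ), (0 : ℝ)) t :=
    (hasDerivAt_id t).prodMk (hasDerivAt_const t x)
  exact h1.comp_hasDerivAt t h2

lemma Smooth2.comm {F : ℝ → ℝ → ℝ} (h : Smooth2 F) (t x : ℝ) :
    pdt (_root_.pdx F) t x = _root_.pdx (pdt F) t x := by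
  have h0 : ContDiff ℝ (⊤ : ℕ∞) (fderiv ℝ (Function.uncurry F)) := h.fderiv_right (by simp)
  have hd : DifferentiableAt ℝ (fderiv ℝ (Function.uncurry F)) (t, x) :=
    h0.differentiable (by simp) _
  have e1 : Function.uncurry (_root_.pdx F) = fun p => fderiv ℝ (Function.uncurry F) p (0, 1) := by
    ext ⟨a, b⟩; rfl
  have e2 : Function.uncurry (pdt F) = fun p => fderiv ℝ (Function.uncurry F) p (1, 0) := by
    ext ⟨a, b⟩; rfl
  have hs : IsSymmSndFDerivAt ℝ (Function.uncurry F) (t, x) :=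
    ContDiffAt.isSymmSndFDerivAt (n := (⊤ : ℕ∞)) h.contDiffAt
      (by simp only [minSmoothness_of_isRCLikeNormedField]; exact WithTop.coe_le_coe.2 (le_top : (2 : ℕ∞) ≤ ⊤))
  rw [pdt, _root_.pdx, e1, e2]
  rw [fderiv_clm_apply hd (by fun_prop), fderiv_clm_apply hd (by fun_prop)]
  simpa using hs (1, 0) (0, 1)

lemma param_deriv {R : ℝ} (hR : 0 ≤ R) {ψ : ℝ → ℝ} (hψ : ContinuousOn ψ (Set.Icc 0 R))
    {g g' : ℝ → ℝ → ℝ} (hg : ∀ t, Continuous (g t)) (hg' : Continuous (Function.uncurry g'))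
    (hd : ∀ t x, HasDerivAt (fun s => g s x) (g' t x) t) (t : ℝ) :
    HasDerivAt (fun s => ∫ x in (0 : ℝ)..R, ψ x * g s x) (∫ x in (0 : ℝ)..R, ψ x * g' t x) t := by
  have hc : IsCompact (Set.Icc (t - 1) (t + 1) ×ˢ Set.Icc 0 R) := isCompact_Icc.prod isCompact_Icc
  obtain ⟨C, hC⟩ := hc.exists_bound_of_continuousOn (f := fun p : ℝ × ℝ => ψ p.2 * g' p.1 p.2)
    (by
      apply ContinuousOn.mul
      · exact hψ.comp continuousOn_snd (fun p hp => hp.2)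
      · exact hg'.continuousOn)
  have hu : Set.uIoc 0 R ⊆ Set.Icc 0 R := by
    rw [Set.uIoc_of_le hR]; exact Set.Ioc_subset_Icc_self
  have hcont : ∀ k : ℝ → ℝ, Continuous k → ContinuousOn (fun x => ψ x * k x) (Set.Icc 0 R) :=
    fun k hk => hψ.mul hk.continuousOn
  have hg't : Continuous (g' t) := hg'.comp (by fun_prop : Continuous fun x : ℝ => (t, x))
  refine (intervalIntegral.hasDerivAt_integral_of_dominated_loc_of_deriv_le
    (s := Set.Icc (t - 1) (t + 1)) (bound := fun _ => C)
    (F := fun s x => ψ x * g s x) (F' := fun s x => ψ x * g' s x)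
    (Icc_mem_nhds (by linarith) (by linarith)) ?_ ?_ ?_ ?_ ?_ ?_).2
  · exact Eventually.of_forall fun s =>
      ((hcont _ (hg s)).mono hu).aestronglyMeasurable measurableSet_uIoc
  · apply ContinuousOn.intervalIntegrable
    rw [Set.uIcc_of_le hR]; exact hcont _ (hg t)
  · exact ((hcont _ hg't).mono hu).aestronglyMeasurable measurableSet_uIoc
  · exact Eventually.of_forall fun x hx s hs => hC (s, x) ⟨hs, hu hx⟩
  · exact intervalIntegrable_const
  · exact Eventually.of_forall fun x hx s hs => (hd s x).const_mul (ψ x)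

/-- Barbalat-type lemma. -/
lemma tendsto_zero_of_bdd {N N' : ℝ → ℝ} {K L B : ℝ} (hN : ∀ t, HasDerivAt N (N' t) t)
    (hN'c : Continuous N') (h0 : ∀ t, 0 ≤ N t) (hB : ∀ t, N t ≤ B) (hL : ∀ t, |N' t| ≤ L)
    (hK : ∀ T, 0 ≤ T → ∫ t in (0 : ℝ)..T, N t ≤ K) : Tendsto N atTop (nhds 0) := by
  have hNc : Continuous N := continuous_iff_continuousAt.2 fun t => (hN t).continuousAt
  have hNint : IntegrableOn N (Set.Ioi 0) := by
    apply integrableOn_Ioi_of_intervalIntegral_norm_bounded (l := atTop) (b := fun T : ℝ => T) K 0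
    · intro i; exact (hNc.integrableOn_Icc).mono_set Set.Ioc_subset_Icc_self
    · exact tendsto_id
    · filter_upwards [eventually_ge_atTop 0] with T hT
      have : ∀ t, ‖N t‖ = N t := fun t => by rw [Real.norm_eq_abs, abs_of_nonneg (h0 t)]
      simpa [this] using hK T hT
  have hsq : Tendsto (fun t => N t * N t) atTop (nhds 0) := by
    apply tendsto_zero_of_hasDerivAt_of_integrableOn_Ioi (a := 0)
      (f' := fun t => N' t * N t + N t * N' t)
    · intro x _; exact (hN x).mul (hN x)
    · refine Integrable.mono' (hNint.const_mul (2 * L)) (by fun_prop) ?_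
      refine Eventually.of_forall fun t => ?_
      have := hL t; have := h0 t
      rw [Real.norm_eq_abs]
      have e : N' t * N t + N t * N' t = 2 * (N' t) * N t := by ring
      rw [e, abs_mul, abs_mul, abs_of_nonneg (h0 t)]
      norm_num
      gcongr
    · refine Integrable.mono' (hNint.const_mul B) (by fun_prop) ?_
      refine Eventually.of_forall fun t => ?_
      have := hB t; have := h0 t
      rw [Real.norm_eq_abs, abs_of_nonneg (by positivity)]
      gcongr
  have := hsq.sqrt
  simpa [Real.sqrt_mul_self, h0] using this

/-- Real form of the equation, with `u = a + i b`. -/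
structure Sol (e E : ℝ) (a b a1 b1 a2 b2 a3 b3 : ℝ → ℝ → ℝ) : Prop where
  ca : Continuous (Function.uncurry a)
  cb : Continuous (Function.uncurry b)
  ca1 : Continuous (Function.uncurry a1)
  cb1 : Continuous (Function.uncurry b1)
  ca2 : Continuous (Function.uncurry a2)
  cb2 : Continuous (Function.uncurry b2)
  ca3 : Continuous (Function.uncurry a3)
  cb3 : Continuous (Function.uncurry b3)
  da : ∀ t x, HasDerivAt (a t) (a1 t x) x
  db : ∀ t x, HasDerivAt (b t) (b1 t x) x
  da1 : ∀ t x, HasDerivAt (a1 t) (a2 t x) x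
  db1 : ∀ t x, HasDerivAt (b1 t) (b2 t x) x
  da2 : ∀ t x, HasDerivAt (a2 t) (a3 t x) x
  db2 : ∀ t x, HasDerivAt (b2 t) (b3 t x) x
  ta : ∀ t x, HasDerivAt (fun s => a s x)
    (-b2 t x + ((a t x ^ 2 + b t x ^ 2) + e * (a t x ^ 2 + b t x ^ 2) ^ 2) * b t x) t
  tb : ∀ t x, HasDerivAt (fun s => b s x)
    (a2 t x - ((a t x ^ 2 + b t x ^ 2) + e * (a t x ^ 2 + b t x ^ 2) ^ 2) * a t x) t
  ta1 : ∀ t x, HasDerivAt (fun s => a1 s x)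
    (-b3 t x + ((a t x ^ 2 + b t x ^ 2) + e * (a t x ^ 2 + b t x ^ 2) ^ 2) * b1 t x
      + (1 + 2 * e * (a t x ^ 2 + b t x ^ 2)) * (2 * (a t x * a1 t x + b t x * b1 t x)) * b t x) t
  tb1 : ∀ t x, HasDerivAt (fun s => b1 s x)
    (a3 t x - ((a t x ^ 2 + b t x ^ 2) + e * (a t x ^ 2 + b t x ^ 2) ^ 2) * a1 t x
      - (1 + 2 * e * (a t x ^ 2 + b t x ^ 2)) * (2 * (a t x * a1 t x + b t x * b1 t x)) * a t x) t
  a0 : ∀ t, a t 0 = 0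
  b0 : ∀ t, b t 0 = 0
  en : ∀ t R, 0 ≤ R →
    ∫ x in (0 : ℝ)..R, ((a t x ^ 2 + b t x ^ 2) + (a1 t x ^ 2 + b1 t x ^ 2)) ≤ E
  E1 : E ≤ 1
  eE : |e| * E ≤ 1 / 4

lemma cont_slice {g : ℝ → ℝ → ℝ} (h : Continuous (Function.uncurry g)) (t : ℝ) :
    Continuous (g t) := h.comp (by fun_prop : Continuous fun x : ℝ => (t, x))

section
variable {e E : ℝ} {a b a1 b1 a2 b2 a3 b3 : ℝ → ℝ → ℝ}

/-- weighted pointwise bound -/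
lemma Sol.ptw (S : Sol e E a b a1 b1 a2 b2 a3 b3) (t : ℝ) {x R δ : ℝ} (hx : 0 ≤ x) (hxR : x ≤ R)
    (hδ : 0 < δ) :
    a t x ^ 2 + b t x ^ 2 ≤ (∫ y in (0 : ℝ)..R, (a t y ^ 2 + b t y ^ 2)) / δ + δ * E := by
  have ca := cont_slice S.ca t
  have cb := cont_slice S.cb t
  have ca1 := cont_slice S.ca1 t
  have cb1 := cont_slice S.cb1 t
  have hR : 0 ≤ R := hx.trans hxR
  have h1 : ∫ y in (0 : ℝ)..x, 2 * (a t y * a1 t y + b t y * b1 t y)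
      = a t x ^ 2 + b t x ^ 2 := by
    rw [intervalIntegral.integral_eq_sub_of_hasDerivAt (f := fun y => a t y ^ 2 + b t y ^ 2)]
    · simp [S.a0, S.b0]
    · intro y _
      refine (((S.da t y).fun_pow 2).fun_add ((S.db t y).fun_pow 2)).congr_deriv ?_
      norm_num; ring
    · apply Continuous.intervalIntegrable; fun_prop
  have h2 : ∫ y in (0 : ℝ)..x, 2 * (a t y * a1 t y + b t y * b1 t y)
      ≤ ∫ y in (0 : ℝ)..x, ((a t y ^ 2 + b t y ^ 2) * δ⁻¹ + δ * (a1 t y ^ 2 + b1 t y ^ 2)) := by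
    apply intervalIntegral.integral_mono_on hx
    · apply Continuous.intervalIntegrable; fun_prop
    · apply Continuous.intervalIntegrable; fun_prop
    · intro y _
      have e1 : (a t y ^ 2 + b t y ^ 2) * δ⁻¹ + δ * (a1 t y ^ 2 + b1 t y ^ 2)
          - 2 * (a t y * a1 t y + b t y * b1 t y)
          = δ⁻¹ * ((a t y - δ * a1 t y) ^ 2 + (b t y - δ * b1 t y) ^ 2) := by
        field_simp; ring
      have : 0 ≤ δ⁻¹ * ((a t y - δ * a1 t y) ^ 2 + (b t y - δ * b1 t y) ^ 2) := by positivity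
      linarith
  rw [h1, intervalIntegral.integral_add (by apply Continuous.intervalIntegrable; fun_prop)
    (by apply Continuous.intervalIntegrable; fun_prop), intervalIntegral.integral_mul_const,
    intervalIntegral.integral_const_mul] at h2
  have h3 : ∫ y in (0 : ℝ)..x, (a1 t y ^ 2 + b1 t y ^ 2) ≤ E := by
    refine le_trans ?_ (S.en t x hx)
    apply intervalIntegral.integral_mono_on hx
    · apply Continuous.intervalIntegrable; fun_prop
    · apply Continuous.intervalIntegrable; fun_prop
    · intro y _; nlinarith [sq_nonneg (a t y), sq_nonneg (b t y)]
  have h4 : ∫ y in (0 : ℝ)..x, (a t y ^ 2 + b t y ^ 2)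
      ≤ ∫ y in (0 : ℝ)..R, (a t y ^ 2 + b t y ^ 2) := by
    apply intervalIntegral.integral_mono_interval le_rfl hx hxR
    · exact Eventually.of_forall fun y => by positivity
    · apply Continuous.intervalIntegrable; fun_prop
  rw [div_eq_mul_inv]
  refine h2.trans ?_
  gcongr

lemma Sol.sup (S : Sol e E a b a1 b1 a2 b2 a3 b3) (t : ℝ) {x : ℝ} (hx : 0 ≤ x) :
    a t x ^ 2 + b t x ^ 2 ≤ E := by
  have ca := cont_slice S.ca t
  have cb := cont_slice S.cb t
  have ca1 := cont_slice S.ca1 t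
  have cb1 := cont_slice S.cb1 t
  have h1 : ∫ y in (0 : ℝ)..x, 2 * (a t y * a1 t y + b t y * b1 t y)
      = a t x ^ 2 + b t x ^ 2 := by
    rw [intervalIntegral.integral_eq_sub_of_hasDerivAt (f := fun y => a t y ^ 2 + b t y ^ 2)]
    · simp [S.a0, S.b0]
    · intro y _
      refine (((S.da t y).fun_pow 2).fun_add ((S.db t y).fun_pow 2)).congr_deriv ?_
      norm_num; ring
    · apply Continuous.intervalIntegrable; fun_prop
  rw [← h1]
  refine le_trans ?_ (S.en t x hx)
  apply intervalIntegral.integral_mono_on hx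
  · apply Continuous.intervalIntegrable; fun_prop
  · apply Continuous.intervalIntegrable; fun_prop
  · intro y _; nlinarith [sq_nonneg (a t y - a1 t y), sq_nonneg (b t y - b1 t y)]

/-- time derivative of the momentum density -/
noncomputable def pt (e : ℝ) (a b a1 b1 a2 b2 a3 b3 : ℝ → ℝ → ℝ) (t x : ℝ) : ℝ :=
  -(a1 t x * a2 t x) - b1 t x * b2 t x + a t x * a3 t x + b t x * b3 t x
    - (1 + 2 * e * (a t x ^ 2 + b t x ^ 2)) * (2 * (a t x * a1 t x + b t x * b1 t x))
      * (a t x ^ 2 + b t x ^ 2)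

lemma Sol.cont_pt (S : Sol e E a b a1 b1 a2 b2 a3 b3) :
    Continuous (Function.uncurry (pt e a b a1 b1 a2 b2 a3 b3)) := by
  have h1 : Continuous fun p : ℝ × ℝ => a p.1 p.2 := S.ca
  have h2 : Continuous fun p : ℝ × ℝ => b p.1 p.2 := S.cb
  have h3 : Continuous fun p : ℝ × ℝ => a1 p.1 p.2 := S.ca1
  have h4 : Continuous fun p : ℝ × ℝ => b1 p.1 p.2 := S.cb1
  have h5 : Continuous fun p : ℝ × ℝ => a2 p.1 p.2 := S.ca2
  have h6 : Continuous fun p : ℝ × ℝ => b2 p.1 p.2 := S.cb2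
  have h7 : Continuous fun p : ℝ × ℝ => a3 p.1 p.2 := S.ca3
  have h8 : Continuous fun p : ℝ × ℝ => b3 p.1 p.2 := S.cb3
  show Continuous fun p : ℝ × ℝ => pt e a b a1 b1 a2 b2 a3 b3 p.1 p.2
  unfold pt
  fun_prop

lemma Sol.dp (S : Sol e E a b a1 b1 a2 b2 a3 b3) (t x : ℝ) :
    HasDerivAt (fun s => a s x * b1 s x - b s x * a1 s x) (pt e a b a1 b1 a2 b2 a3 b3 t x) t := by
  refine (((S.ta t x).fun_mul (S.tb1 t x)).fun_sub
    ((S.tb t x).fun_mul (S.ta1 t x))).congr_deriv ?_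
  unfold pt; ring

lemma algebra_aux {s q r G w y ρ : ℝ} (hw0 : 0 ≤ w) (hw1 : w ≤ 1) (hy0 : 0 ≤ y) (hy1 : y ≤ 1)
    (hρ0 : 0 ≤ ρ) (hρ1 : ρ ≤ 1) (hs0 : 0 ≤ s) (hq0 : 0 ≤ q) (hG0 : 0 ≤ G) (hG1 : G ≤ s)
    (hr1 : |r| ≤ (s + q) / 2)
    (hmain : 0 ≤ y ^ 2 * (2 * w ^ 2 * q - 6 * w ^ 3 * r + (9 / 2) * w ^ 4 * s)) :
    3 / 2 * (y ^ 2 * w ^ 4) * s - 10 * ρ * (s + q) ≤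
    2 * (w ^ 2 * y ^ 2 - 2 * ρ * (1 - w) * y) * q
    + (-2 * w ^ 3 * y ^ 2 - 4 * ρ * w ^ 2 * y + 2 * ρ ^ 2 * (1 - w) + 2 * (-2 * w ^ 3 * y ^ 2)) * r
    + (w ^ 2 * y ^ 2 - 2 * ρ * (1 - w) * y) * G
    + (6 * w ^ 4 * y ^ 2 + 4 * ρ * w ^ 3 * y) * s := by
  have hm1 : 0 ≤ (1 - w) * y := mul_nonneg (by linarith) hy0
  have hm2 : (1 - w) * y ≤ 1 := by nlinarith
  have e1 : ((1 - w) * y) * (4 * q + 2 * G) ≤ 1 * (4 * q + 2 * s) := by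
    gcongr
  have h5 : |(- 4 * w ^ 2 * y + 2 * ρ * (1 - w))| ≤ 4 := by
    have h1 : w ^ 2 * y ≤ 1 := mul_le_one₀ (pow_le_one₀ hw0 hw1) hy0 hy1
    have h2 : ρ * (1 - w) ≤ 1 := mul_le_one₀ hρ1 (by linarith) (by linarith)
    have h3 : 0 ≤ ρ * (1 - w) := mul_nonneg hρ0 (by linarith)
    have h4 : 0 ≤ w ^ 2 * y := by positivity
    rw [abs_le]; constructor <;> linarith
  have e2 : |(- 4 * w ^ 2 * y + 2 * ρ * (1 - w)) * r| ≤ 4 * ((s + q) / 2) := by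
    rw [abs_mul]
    exact mul_le_mul h5 hr1 (abs_nonneg _) (by norm_num)
  have e2' := (abs_le.1 e2).1
  have e3 : 0 ≤ w ^ 2 * y ^ 2 * G := by positivity
  have e4 : 0 ≤ 4 * ρ * w ^ 3 * y * s := by positivity
  have e5 : 0 ≤ ρ * (10 * (s + q) - ((1 - w) * y) * (4 * q + 2 * G)
      + (- 4 * w ^ 2 * y + 2 * ρ * (1 - w)) * r) := by
    apply mul_nonneg hρ0; linarith
  linear_combination hmain + e3 + e4 + e5

lemma algebra_bound {e E A B A1 B1 w y ρ : ℝ} (hw0 : 0 ≤ w) (hw1 : w ≤ 1) (hy0 : 0 ≤ y) (hy1 : y ≤ 1)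
    (hρ0 : 0 ≤ ρ) (hρ1 : ρ ≤ 1) (hs : A ^ 2 + B ^ 2 ≤ E) (hE : E ≤ 1) (heE : |e| * E ≤ 1 / 4) :
    3 / 2 * (y ^ 2 * w ^ 4) * (A ^ 2 + B ^ 2) - 10 * ρ * ((A ^ 2 + B ^ 2) + (A1 ^ 2 + B1 ^ 2)) ≤
    2 * (w ^ 2 * y ^ 2 - 2 * ρ * (1 - w) * y) * (A1 ^ 2 + B1 ^ 2)
    + (-2 * w ^ 3 * y ^ 2 - 4 * ρ * w ^ 2 * y + 2 * ρ ^ 2 * (1 - w) + 2 * (-2 * w ^ 3 * y ^ 2))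
        * (A * A1 + B * B1)
    + (w ^ 2 * y ^ 2 - 2 * ρ * (1 - w) * y)
      * ((A ^ 2 + B ^ 2) ^ 2 / 2 + 2 / 3 * e * (A ^ 2 + B ^ 2) ^ 3)
    + (6 * w ^ 4 * y ^ 2 + 4 * ρ * w ^ 3 * y) * (A ^ 2 + B ^ 2) := by
  have hs0 : 0 ≤ A ^ 2 + B ^ 2 := by positivity
  have hes : |e * (A ^ 2 + B ^ 2)| ≤ 1 / 4 := by
    rw [abs_mul, abs_of_nonneg hs0]
    exact (mul_le_mul_of_nonneg_left hs (abs_nonneg e)).trans heE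
  obtain ⟨he1, he2⟩ := abs_le.1 hes
  have hG : (A ^ 2 + B ^ 2) ^ 2 / 2 + 2 / 3 * e * (A ^ 2 + B ^ 2) ^ 3
    = (A ^ 2 + B ^ 2) ^ 2 * (1 / 2 + 2 / 3 * (e * (A ^ 2 + B ^ 2))) := by ring
  have hs1 : A ^ 2 + B ^ 2 ≤ 1 := hs.trans hE
  apply algebra_aux hw0 hw1 hy0 hy1 hρ0 hρ1 hs0 (by positivity)
  · rw [hG]; apply mul_nonneg (by positivity); linarith
  · rw [hG]
    generalize A ^ 2 + B ^ 2 = s at *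
    calc s ^ 2 * (1 / 2 + 2 / 3 * (e * s)) ≤ s ^ 2 * 1 := by gcongr; linarith
      _ ≤ s := by nlinarith
  · rw [abs_le]
    constructor <;> nlinarith [sq_nonneg (A - A1), sq_nonneg (B - B1), sq_nonneg (A + A1), sq_nonneg (B + B1)]
  · apply mul_nonneg (by positivity)
    have : 2 * w ^ 2 * (A1 ^ 2 + B1 ^ 2) - 6 * w ^ 3 * (A * A1 + B * B1)
        + (9 / 2) * w ^ 4 * (A ^ 2 + B ^ 2)
      = 2 * w ^ 2 * ((A1 - 3 / 2 * w * A) ^ 2 + (B1 - 3 / 2 * w * B) ^ 2) := by ring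
    rw [this]; positivity


noncomputable def wt (x : ℝ) : ℝ := (1 + x)⁻¹

lemma hasDerivAt_wt {x : ℝ} (hx : 0 ≤ x) : HasDerivAt wt (-(wt x) ^ 2) x := by
  have h : HasDerivAt (fun x : ℝ => 1 + x) 1 x := by
    simpa using (hasDerivAt_id x).const_add 1
  refine (h.fun_inv (by positivity)).congr_deriv ?_
  unfold wt
  field_simp

lemma continuousOn_wt {R : ℝ} : ContinuousOn wt (Set.Icc 0 R) :=
  fun _ hx => (hasDerivAt_wt hx.1).continuousAt.continuousWithinAt

lemma wt_nonneg {x : ℝ} (hx : 0 ≤ x) : 0 ≤ wt x := by unfold wt; positivity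

lemma wt_le {x : ℝ} (hx : 0 ≤ x) : wt x ≤ 1 := by
  unfold wt; exact inv_le_one_of_one_le₀ (by linarith)

lemma Sol.virial (S : Sol e E a b a1 b1 a2 b2 a3 b3) (t : ℝ) {R : ℝ} (hR : 1 ≤ R) :
    (∫ x in (0 : ℝ)..R, 3 / 2 * ((1 - R⁻¹ * x) ^ 2 * wt x ^ 4) * (a t x ^ 2 + b t x ^ 2))
      - 10 * R⁻¹ * E ≤
    ∫ x in (0 : ℝ)..R, ((1 - wt x) * (1 - R⁻¹ * x) ^ 2) * pt e a b a1 b1 a2 b2 a3 b3 t x := by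
  have hR0 : 0 < R := by linarith
  have hρ0 : 0 ≤ R⁻¹ := by positivity
  have hρ1 : R⁻¹ ≤ 1 := inv_le_one_of_one_le₀ hR
  have hρR : R⁻¹ * R = 1 := inv_mul_cancel₀ hR0.ne'
  generalize R⁻¹ = ρ at *
  have ca := cont_slice S.ca t
  have cb := cont_slice S.cb t
  have ca1 := cont_slice S.ca1 t
  have cb1 := cont_slice S.cb1 t
  have cpt := cont_slice S.cont_pt t
  have cw : ContinuousOn wt (Set.uIcc 0 R) := by rw [Set.uIcc_of_le hR0.le]; exact continuousOn_wt
  let J : ℝ → ℝ := fun x =>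
    2 * (wt x ^ 2 * (1 - ρ * x) ^ 2 - 2 * ρ * (1 - wt x) * (1 - ρ * x)) * (a1 t x ^ 2 + b1 t x ^ 2)
    + (-2 * wt x ^ 3 * (1 - ρ * x) ^ 2 - 4 * ρ * wt x ^ 2 * (1 - ρ * x) + 2 * ρ ^ 2 * (1 - wt x)
        + 2 * (-2 * wt x ^ 3 * (1 - ρ * x) ^ 2))
        * (a t x * a1 t x + b t x * b1 t x)
    + (wt x ^ 2 * (1 - ρ * x) ^ 2 - 2 * ρ * (1 - wt x) * (1 - ρ * x))
      * ((a t x ^ 2 + b t x ^ 2) ^ 2 / 2 + 2 / 3 * e * (a t x ^ 2 + b t x ^ 2) ^ 3)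
    + (6 * wt x ^ 4 * (1 - ρ * x) ^ 2 + 4 * ρ * wt x ^ 3 * (1 - ρ * x)) * (a t x ^ 2 + b t x ^ 2)
  have hJ : IntervalIntegrable J volume 0 R := by
    apply ContinuousOn.intervalIntegrable
    fun_prop
  have hP : IntervalIntegrable (fun x => ((1 - wt x) * (1 - ρ * x) ^ 2)
      * pt e a b a1 b1 a2 b2 a3 b3 t x) volume 0 R := by
    apply ContinuousOn.intervalIntegrable
    fun_prop
  have hftc : ∫ x in (0 : ℝ)..R, (((1 - wt x) * (1 - ρ * x) ^ 2)
      * pt e a b a1 b1 a2 b2 a3 b3 t x - J x) = 0 := by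
    rw [intervalIntegral.integral_eq_sub_of_hasDerivAt (f := fun x =>
      ((1 - wt x) * (1 - ρ * x) ^ 2) * (-(a1 t x ^ 2 + b1 t x ^ 2)
        + (a t x * a2 t x + b t x * b2 t x)
        - ((a t x ^ 2 + b t x ^ 2) ^ 2 / 2 + 2 / 3 * e * (a t x ^ 2 + b t x ^ 2) ^ 3))
      - (wt x ^ 2 * (1 - ρ * x) ^ 2 - 2 * ρ * (1 - wt x) * (1 - ρ * x))
        * (a t x * a1 t x + b t x * b1 t x)
      - (-2 * wt x ^ 3 * (1 - ρ * x) ^ 2) * (a t x ^ 2 + b t x ^ 2)) _ (hP.sub hJ)]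
    · have : wt 0 = 1 := by simp [wt]
      simp [S.a0, S.b0, hρR, this]
    · intro x hx
      rw [Set.uIcc_of_le hR0.le] at hx
      have dw := hasDerivAt_wt hx.1
      have dy : HasDerivAt (fun x => 1 - ρ * x) (-ρ) x := by
        simpa using ((hasDerivAt_id x).const_mul ρ).const_sub 1
      have dφ : HasDerivAt (fun x => 1 - wt x) (wt x ^ 2) x := by
        simpa using dw.const_sub 1
      have da := S.da t x
      have db := S.db t x
      have da1 := S.da1 t x
      have db1 := S.db1 t x
      have da2 := S.da2 t x
      have db2 := S.db2 t x
      have dy2 := dy.fun_pow 2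
      have dw2 := dw.fun_pow 2
      have dw3 := dw.fun_pow 3
      have dq := (da1.fun_pow 2).fun_add (db1.fun_pow 2)
      have ds := (da.fun_pow 2).fun_add (db.fun_pow 2)
      have dr := (da.fun_mul da1).fun_add (db.fun_mul db1)
      have dv := (da.fun_mul da2).fun_add (db.fun_mul db2)
      have dG := ((ds.fun_pow 2).div_const 2).fun_add ((ds.fun_pow 3).const_mul (2 / 3 * e))
      have dQ := ((dq.fun_neg).fun_add dv).fun_sub dG
      have dψ := dφ.fun_mul dy2
      have dψ1 := (dw2.fun_mul dy2).fun_sub ((dφ.const_mul (2 * ρ)).fun_mul dy)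
      have dk := (dw3.const_mul (-2)).fun_mul dy2
      refine (((dψ.fun_mul dQ).fun_sub (dψ1.fun_mul dr)).fun_sub (dk.fun_mul ds)).congr_deriv ?_
      simp only [J, pt]
      push_cast
      norm_num
      ring
  rw [intervalIntegral.integral_sub hP hJ, sub_eq_zero] at hftc
  rw [hftc]
  have hen := S.en t R hR0.le
  have i1 : IntervalIntegrable (fun x => 3 / 2 * ((1 - ρ * x) ^ 2 * wt x ^ 4)
      * (a t x ^ 2 + b t x ^ 2)) volume 0 R := by
    apply ContinuousOn.intervalIntegrable
    fun_prop
  have i2 : IntervalIntegrable (fun x => 10 * ρ *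
      ((a t x ^ 2 + b t x ^ 2) + (a1 t x ^ 2 + b1 t x ^ 2))) volume 0 R := by
    apply Continuous.intervalIntegrable
    fun_prop
  have hmono := intervalIntegral.integral_mono_on hR0.le (i1.sub i2) hJ (by
    intro x hx
    have h1 : ρ * x ≤ 1 := by rw [← hρR]; exact mul_le_mul_of_nonneg_left hx.2 hρ0
    have h2 : 0 ≤ ρ * x := mul_nonneg hρ0 hx.1
    exact algebra_bound (wt_nonneg hx.1) (wt_le hx.1) (by linarith) (by linarith) hρ0 hρ1
      (S.sup t hx.1) S.E1 S.eE)
  rw [intervalIntegral.integral_sub i1 i2, intervalIntegral.integral_const_mul (10 * ρ)] at hmono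
  refine le_trans ?_ hmono
  gcongr

/-- the localized mass -/
noncomputable def locN (a b : ℝ → ℝ → ℝ) (A t : ℝ) : ℝ :=
  ∫ x in (0 : ℝ)..A, (A - x) * (a t x ^ 2 + b t x ^ 2)

lemma Sol.dN (S : Sol e E a b a1 b1 a2 b2 a3 b3) {A : ℝ} (hA : 0 ≤ A) (t : ℝ) :
    HasDerivAt (locN a b A)
      (∫ x in (0 : ℝ)..A, (A - x) * (2 * (b t x * a2 t x - a t x * b2 t x))) t := by
  have h1 : Continuous fun p : ℝ × ℝ => a p.1 p.2 := S.ca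
  have h2 : Continuous fun p : ℝ × ℝ => b p.1 p.2 := S.cb
  have h5 : Continuous fun p : ℝ × ℝ => a2 p.1 p.2 := S.ca2
  have h6 : Continuous fun p : ℝ × ℝ => b2 p.1 p.2 := S.cb2
  refine param_deriv hA (ψ := fun x => A - x) (g := fun t x => a t x ^ 2 + b t x ^ 2)
    (g' := fun t x => 2 * (b t x * a2 t x - a t x * b2 t x)) (by fun_prop) ?_ ?_ ?_ t
  · intro t
    have ca := cont_slice S.ca t
    have cb := cont_slice S.cb t
    fun_prop
  · show Continuous fun p : ℝ × ℝ => 2 * (b p.1 p.2 * a2 p.1 p.2 - a p.1 p.2 * b2 p.1 p.2)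
    fun_prop
  · intro t x
    refine (((S.ta t x).fun_pow 2).fun_add ((S.tb t x).fun_pow 2)).congr_deriv ?_
    norm_num
    ring

lemma Sol.dN_cont (S : Sol e E a b a1 b1 a2 b2 a3 b3) {A : ℝ} :
    Continuous fun t =>
      ∫ x in (0 : ℝ)..A, (A - x) * (2 * (b t x * a2 t x - a t x * b2 t x)) := by
  have h1 : Continuous fun p : ℝ × ℝ => a p.1 p.2 := S.ca
  have h2 : Continuous fun p : ℝ × ℝ => b p.1 p.2 := S.cb
  have h5 : Continuous fun p : ℝ × ℝ => a2 p.1 p.2 := S.ca2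
  have h6 : Continuous fun p : ℝ × ℝ => b2 p.1 p.2 := S.cb2
  apply intervalIntegral.continuous_parametric_intervalIntegral_of_continuous'
  show Continuous fun p : ℝ × ℝ => (A - p.2) *
    (2 * (b p.1 p.2 * a2 p.1 p.2 - a p.1 p.2 * b2 p.1 p.2))
  fun_prop

lemma Sol.abs_p (S : Sol e E a b a1 b1 a2 b2 a3 b3) (t : ℝ) {R : ℝ} (hR : 0 ≤ R) {ψ : ℝ → ℝ}
    (hψ : ∀ x ∈ Set.Icc 0 R, |ψ x| ≤ 1) :
    |∫ x in (0 : ℝ)..R, ψ x * (a t x * b1 t x - b t x * a1 t x)| ≤ E := by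
  have ca := cont_slice S.ca t
  have cb := cont_slice S.cb t
  have ca1 := cont_slice S.ca1 t
  have cb1 := cont_slice S.cb1 t
  rw [← Real.norm_eq_abs]
  refine (intervalIntegral.norm_integral_le_of_norm_le hR (g := fun x =>
    (a t x ^ 2 + b t x ^ 2) + (a1 t x ^ 2 + b1 t x ^ 2)) ?_ ?_).trans (S.en t R hR)
  · refine Eventually.of_forall fun x hx => ?_
    have h1 := hψ x (Set.Ioc_subset_Icc_self hx)
    have h2 : |a t x * b1 t x - b t x * a1 t x| ≤
        (a t x ^ 2 + b t x ^ 2) + (a1 t x ^ 2 + b1 t x ^ 2) := by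
      rw [abs_le]
      constructor <;> nlinarith [sq_nonneg (a t x - b1 t x), sq_nonneg (a t x + b1 t x),
        sq_nonneg (b t x - a1 t x), sq_nonneg (b t x + a1 t x)]
    rw [Real.norm_eq_abs, abs_mul]
    calc _ ≤ 1 * |a t x * b1 t x - b t x * a1 t x| := by gcongr
      _ ≤ _ := by rw [one_mul]; exact h2
  · apply Continuous.intervalIntegrable; fun_prop

lemma Sol.dN_bound (S : Sol e E a b a1 b1 a2 b2 a3 b3) {A : ℝ} (hA : 0 ≤ A) (t : ℝ) :
    |∫ x in (0 : ℝ)..A, (A - x) * (2 * (b t x * a2 t x - a t x * b2 t x))| ≤ 2 * E := by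
  have ca := cont_slice S.ca t
  have cb := cont_slice S.cb t
  have ca1 := cont_slice S.ca1 t
  have cb1 := cont_slice S.cb1 t
  have ca2 := cont_slice S.ca2 t
  have cb2 := cont_slice S.cb2 t
  have i1 : IntervalIntegrable (fun x => (A - x) * (2 * (b t x * a2 t x - a t x * b2 t x)))
      volume 0 A := by apply Continuous.intervalIntegrable; fun_prop
  have i2 : IntervalIntegrable (fun x => 2 * (1 * (a t x * b1 t x - b t x * a1 t x)))
      volume 0 A := by apply Continuous.intervalIntegrable; fun_prop
  have hftc : ∫ x in (0 : ℝ)..A, ((A - x) * (2 * (b t x * a2 t x - a t x * b2 t x))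
      + 2 * (1 * (a t x * b1 t x - b t x * a1 t x))) = 0 := by
    rw [intervalIntegral.integral_eq_sub_of_hasDerivAt (f := fun x =>
      (A - x) * (2 * (b t x * a1 t x - a t x * b1 t x))) _ (i1.add i2)]
    · simp [S.a0, S.b0]
    · intro x hx
      have dA : HasDerivAt (fun x => A - x) (-1) x := by
        simpa using (hasDerivAt_id x).const_sub A
      refine (dA.fun_mul ((((S.db t x).fun_mul (S.da1 t x)).fun_sub
        ((S.da t x).fun_mul (S.db1 t x))).const_mul 2)).congr_deriv ?_
      ring
  rw [intervalIntegral.integral_add i1 i2, intervalIntegral.integral_const_mul] at hftc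
  have h := S.abs_p t hA (ψ := fun _ => 1) (by simp)
  rw [eq_neg_of_add_eq_zero_left hftc, abs_neg, abs_mul, abs_two]
  gcongr

lemma Sol.N_int (S : Sol e E a b a1 b1 a2 b2 a3 b3) {A : ℝ} (hA : 1 ≤ A) {T : ℝ} (hT : 0 ≤ T) :
    ∫ t in (0 : ℝ)..T, locN a b A t ≤ 48 * E * (A * (1 + A) ^ 4) := by
  have hA0 : 0 ≤ A := by linarith
  have hE : 0 ≤ E := le_trans (by positivity) (S.sup 0 (le_refl (0 : ℝ)))
  obtain ⟨R, hRA, hRT⟩ : ∃ R : ℝ, 2 * A ≤ R ∧ T ≤ R := ⟨max (2 * A) T, le_max_left _ _, le_max_right _ _⟩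
  have hR : 1 ≤ R := by linarith
  have hR0 : 0 < R := by linarith
  have hρR : R⁻¹ * R = 1 := inv_mul_cancel₀ hR0.ne'
  have hρ0 : 0 ≤ R⁻¹ := by positivity
  have hNc : Continuous (locN a b A) :=
    continuous_iff_continuousAt.2 fun t => (S.dN hA0 t).continuousAt
  set c : ℝ := (A * (1 + A) ^ 4)⁻¹ / 4 with hc
  have hc0 : 0 < c := by positivity
  let ψ : ℝ → ℝ := fun x => (1 - wt x) * (1 - R⁻¹ * x) ^ 2
  have hψc : ContinuousOn ψ (Set.Icc 0 R) := by
    have := continuousOn_wt (R := R)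
    fun_prop
  have hψ1 : ∀ x ∈ Set.Icc 0 R, |ψ x| ≤ 1 := by
    intro x hx
    have h1 : R⁻¹ * x ≤ 1 := by rw [← hρR]; exact mul_le_mul_of_nonneg_left hx.2 hρ0
    have h2 : 0 ≤ R⁻¹ * x := mul_nonneg hρ0 hx.1
    have h3 := wt_nonneg hx.1
    have h4 := wt_le hx.1
    have h5 : 0 ≤ 1 - wt x := by linarith
    rw [abs_of_nonneg (by positivity)]
    apply mul_le_one₀ (by linarith) (by positivity)
    apply pow_le_one₀ <;> linarith
  have dP : ∀ t, HasDerivAt (fun t => ∫ x in (0 : ℝ)..R, ψ x * (a t x * b1 t x - b t x * a1 t x))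
      (∫ x in (0 : ℝ)..R, ψ x * pt e a b a1 b1 a2 b2 a3 b3 t x) t := by
    refine param_deriv hR0.le hψc (g := fun t x => a t x * b1 t x - b t x * a1 t x) ?_ S.cont_pt S.dp
    intro t
    have ca := cont_slice S.ca t
    have cb := cont_slice S.cb t
    have ca1 := cont_slice S.ca1 t
    have cb1 := cont_slice S.cb1 t
    fun_prop
  have hlow : ∀ t, c * locN a b A t - 10 * R⁻¹ * E ≤
      ∫ x in (0 : ℝ)..R, ψ x * pt e a b a1 b1 a2 b2 a3 b3 t x := by
    intro t
    refine le_trans ?_ (S.virial t hR)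
    have ca := cont_slice S.ca t
    have cb := cont_slice S.cb t
    have cw : ContinuousOn wt (Set.uIcc 0 R) := by
      rw [Set.uIcc_of_le hR0.le]; exact continuousOn_wt
    have i1 : IntervalIntegrable (fun x => 3 / 2 * ((1 - R⁻¹ * x) ^ 2 * wt x ^ 4)
        * (a t x ^ 2 + b t x ^ 2)) volume 0 R := by
      apply ContinuousOn.intervalIntegrable
      fun_prop
    gcongr
    calc c * locN a b A t = ∫ x in (0 : ℝ)..A, c * ((A - x) * (a t x ^ 2 + b t x ^ 2)) := by
          rw [locN, intervalIntegral.integral_const_mul]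
      _ ≤ ∫ x in (0 : ℝ)..A, 3 / 2 * ((1 - R⁻¹ * x) ^ 2 * wt x ^ 4) * (a t x ^ 2 + b t x ^ 2) := by
          apply intervalIntegral.integral_mono_on hA0
          · apply Continuous.intervalIntegrable; fun_prop
          · apply i1.mono_set
            rw [Set.uIcc_of_le hR0.le, Set.uIcc_of_le hA0]
            exact Set.Icc_subset_Icc le_rfl (by linarith)
          · intro x hx
            rw [← mul_assoc]
            apply mul_le_mul_of_nonneg_right _ (by positivity)
            have h1 : R⁻¹ * x ≤ 1 / 2 := by
              have : R⁻¹ * (2 * x) ≤ 1 := by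
                rw [← hρR]; exact mul_le_mul_of_nonneg_left (by linarith [hx.2]) hρ0
              linarith
            have h2 : (1 / 2 : ℝ) ^ 2 ≤ (1 - R⁻¹ * x) ^ 2 := by
              apply pow_le_pow_left₀ (by norm_num); linarith
            have h3 : ((1 + A)⁻¹) ^ 4 ≤ wt x ^ 4 := by
              unfold wt
              have := hx.1
              have := hx.2
              gcongr
            have h4 : c * (A - x) ≤ c * A := by
              apply mul_le_mul_of_nonneg_left _ hc0.le; linarith [hx.1]
            have h5 : c * A = (1 / 2 : ℝ) ^ 2 * ((1 + A)⁻¹) ^ 4 := by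
              rw [hc]; field_simp; norm_num
            have h6 : (1 / 2 : ℝ) ^ 2 * ((1 + A)⁻¹) ^ 4 ≤ (1 - R⁻¹ * x) ^ 2 * wt x ^ 4 := by
              gcongr
            have h7 : 0 ≤ (1 - R⁻¹ * x) ^ 2 * wt x ^ 4 := by positivity
            linarith
      _ ≤ _ := by
          apply intervalIntegral.integral_mono_interval le_rfl hA0 (by linarith) _ i1
          refine Eventually.of_forall fun x => ?_
          simp only [Pi.zero_apply]
          positivity
  have hmono : Monotone fun t => (∫ x in (0 : ℝ)..R, ψ x * (a t x * b1 t x - b t x * a1 t x))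
      - c * (∫ s in (0 : ℝ)..t, locN a b A s) + 10 * R⁻¹ * E * t := by
    have hd : ∀ t, HasDerivAt (fun t =>
        (∫ x in (0 : ℝ)..R, ψ x * (a t x * b1 t x - b t x * a1 t x))
        - c * (∫ s in (0 : ℝ)..t, locN a b A s) + 10 * R⁻¹ * E * t)
        ((∫ x in (0 : ℝ)..R, ψ x * pt e a b a1 b1 a2 b2 a3 b3 t x) - c * locN a b A t
          + 10 * R⁻¹ * E * 1) t := by
      intro t
      have h2 : HasDerivAt (fun t => ∫ s in (0 : ℝ)..t, locN a b A s) (locN a b A t) t :=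
        intervalIntegral.integral_hasDerivAt_right (hNc.intervalIntegrable _ _)
          (hNc.stronglyMeasurableAtFilter _ _) hNc.continuousAt
      exact ((dP t).fun_sub (h2.const_mul c)).fun_add ((hasDerivAt_id t).const_mul (10 * R⁻¹ * E))
    apply monotone_of_deriv_nonneg (fun t => (hd t).differentiableAt)
    intro t
    rw [(hd t).deriv]
    linarith [hlow t]
  have h := hmono hT
  simp only [intervalIntegral.integral_same, mul_zero, sub_zero, add_zero] at h
  have p0 := abs_le.1 (S.abs_p 0 hR0.le hψ1)
  have pT := abs_le.1 (S.abs_p T hR0.le hψ1)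
  have hTR : R⁻¹ * T ≤ 1 := by rw [← hρR]; exact mul_le_mul_of_nonneg_left hRT hρ0
  have hTE : 10 * R⁻¹ * E * T ≤ 10 * E := by nlinarith
  have hfin : c * (∫ s in (0 : ℝ)..T, locN a b A s) ≤ 12 * E := by linarith [p0.1, pT.2]
  have hK : 0 < A * (1 + A) ^ 4 := by positivity
  calc (∫ s in (0 : ℝ)..T, locN a b A s)
      = (c * (∫ s in (0 : ℝ)..T, locN a b A s)) * (4 * (A * (1 + A) ^ 4)) := by
        rw [hc]; field_simp
    _ ≤ (12 * E) * (4 * (A * (1 + A) ^ 4)) := by gcongr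
    _ = _ := by ring

lemma Sol.N_tendsto (S : Sol e E a b a1 b1 a2 b2 a3 b3) {A : ℝ} (hA : 1 ≤ A) :
    Tendsto (locN a b A) atTop (nhds 0) := by
  have hA0 : 0 ≤ A := by linarith
  refine tendsto_zero_of_bdd (B := A * E) (fun t => S.dN hA0 t) S.dN_cont ?_ ?_
    (fun t => S.dN_bound hA0 t) (fun T hT => S.N_int hA hT)
  · intro t
    apply intervalIntegral.integral_nonneg hA0
    intro x hx
    have : 0 ≤ A - x := by linarith [hx.2]
    positivity
  · intro t
    have ca := cont_slice S.ca t
    have cb := cont_slice S.cb t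
    have ca1 := cont_slice S.ca1 t
    have cb1 := cont_slice S.cb1 t
    calc locN a b A t ≤ ∫ x in (0 : ℝ)..A, A * ((a t x ^ 2 + b t x ^ 2) + (a1 t x ^ 2 + b1 t x ^ 2)) := by
          apply intervalIntegral.integral_mono_on hA0
          · apply Continuous.intervalIntegrable; fun_prop
          · apply Continuous.intervalIntegrable; fun_prop
          · intro x hx
            have : 0 ≤ A - x := by linarith [hx.2]
            have h2 : A - x ≤ A := by linarith [hx.1]
            have h3 : 0 ≤ a1 t x ^ 2 + b1 t x ^ 2 := by positivity
            exact mul_le_mul h2 (by linarith) (by positivity) hA0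
      _ ≤ A * E := by
          rw [intervalIntegral.integral_const_mul]
          gcongr
          exact S.en t A hA0

/-- local uniform decay on the half line -/
lemma Sol.decay (S : Sol e E a b a1 b1 a2 b2 a3 b3) {B : ℝ} (hB : 0 ≤ B) {η : ℝ} (hη : 0 < η) :
    ∀ᶠ t in atTop, ∀ x ∈ Set.Icc 0 B, a t x ^ 2 + b t x ^ 2 ≤ η := by
  have hδ : 0 < η / 2 := by positivity
  have hE1 := S.E1
  have h := S.N_tendsto (A := B + 1) (by linarith)
  filter_upwards [h.eventually (gt_mem_nhds (show 0 < (η / 2) ^ 2 by positivity))] with t ht x hx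
  have ca := cont_slice S.ca t
  have cb := cont_slice S.cb t
  have h1 := S.ptw t hx.1 hx.2 hδ
  have h2 : ∫ y in (0 : ℝ)..B, (a t y ^ 2 + b t y ^ 2) ≤ locN a b (B + 1) t := by
    calc _ ≤ ∫ y in (0 : ℝ)..B, (B + 1 - y) * (a t y ^ 2 + b t y ^ 2) := by
          apply intervalIntegral.integral_mono_on hB
          · apply Continuous.intervalIntegrable; fun_prop
          · apply Continuous.intervalIntegrable; fun_prop
          · intro y hy
            have : 0 ≤ a t y ^ 2 + b t y ^ 2 := by positivity
            nlinarith [hy.2]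
      _ ≤ _ := by
          unfold locN
          rw [← intervalIntegral.integral_add_adjacent_intervals (a := 0) (b := B) (c := B + 1)
            (by apply Continuous.intervalIntegrable; fun_prop)
            (by apply Continuous.intervalIntegrable; fun_prop)]
          have : 0 ≤ ∫ y in B..(B + 1), (B + 1 - y) * (a t y ^ 2 + b t y ^ 2) := by
            apply intervalIntegral.integral_nonneg (by linarith)
            intro y hy
            have : 0 ≤ B + 1 - y := by linarith [hy.2]
            positivity
          linarith
  have h3 : (∫ y in (0 : ℝ)..B, (a t y ^ 2 + b t y ^ 2)) / (η / 2) ≤ η / 2 := by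
    rw [div_le_iff₀ hδ]; nlinarith
  nlinarith

end

lemma schwartz_sq (g : SchwartzMap ℝ ℂ) : Integrable fun x => ‖g x‖ ^ 2 :=
  (g.memLp 2 volume).integrable_norm_pow (by norm_num)

lemma complex_hasDerivAt {f : ℝ → ℂ} {p q x : ℝ} (hp : HasDerivAt (fun x => (f x).re) p x)
    (hq : HasDerivAt (fun x => (f x).im) q x) : HasDerivAt f (p + q * Complex.I) x := by
  have := hp.ofReal_comp.fun_add (hq.ofReal_comp.mul_const Complex.I)
  simpa [Complex.re_add_im] using this

lemma sol_of (e ε : ℝ) (hε1 : ε ^ 2 ≤ 1) (heE : |e| * ε ^ 2 ≤ 1 / 4) (u : ℝ → ℝ → ℂ)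
    (hu : ContDiff ℝ (⊤ : ℕ∞) (Function.uncurry u))
    (heq : ∀ t x : ℝ, Complex.I * deriv (fun s => u s x) t + deriv (deriv (u t)) x
          = ((‖u t x‖ ^ 2 + e * ‖u t x‖ ^ 4 : ℝ) : ℂ) * u t x)
    (hodd : ∀ t x : ℝ, u t (-x) = - u t x)
    (hS : ∀ t : ℝ, ∃ g : SchwartzMap ℝ ℂ, ∀ x : ℝ, u t x = g x)
    (hen : ∀ t : ℝ, (∫ x : ℝ, ‖u t x‖ ^ 2) + (∫ x : ℝ, ‖deriv (u t) x‖ ^ 2) ≤ ε ^ 2) :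
    ∃ a1 b1 a2 b2 a3 b3 : ℝ → ℝ → ℝ,
      Sol e (ε ^ 2) (fun t x => (u t x).re) (fun t x => (u t x).im) a1 b1 a2 b2 a3 b3 := by
  set a : ℝ → ℝ → ℝ := fun t x => (u t x).re with ha
  set b : ℝ → ℝ → ℝ := fun t x => (u t x).im with hb
  have sa : Smooth2 a := Complex.reCLM.contDiff.comp hu
  have sb : Smooth2 b := Complex.imCLM.contDiff.comp hu
  have sa1 := sa.pdx
  have sb1 := sb.pdx
  have sa2 := sa1.pdx
  have sb2 := sb1.pdx
  have sa3 := sa2.pdx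
  have sb3 := sb2.pdx
  have hux : ∀ t, deriv (u t) = fun x => ((pdx a t x : ℝ) : ℂ) + (pdx b t x : ℝ) * Complex.I := by
    intro t; ext x
    exact (complex_hasDerivAt (sa.hx t x) (sb.hx t x)).deriv
  have huxx : ∀ t x, deriv (deriv (u t)) x
      = ((pdx (pdx a) t x : ℝ) : ℂ) + (pdx (pdx b) t x : ℝ) * Complex.I := by
    intro t x
    rw [hux]
    refine (complex_hasDerivAt ?_ ?_).deriv
    · simpa using sa1.hx t x
    · simpa using sb1.hx t x
  have hut : ∀ t x, deriv (fun s => u s x) t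
      = ((pdt a t x : ℝ) : ℂ) + (pdt b t x : ℝ) * Complex.I := fun t x =>
    (complex_hasDerivAt (f := fun s => u s x) (sa.ht t x) (sb.ht t x)).deriv
  have hns : ∀ z : ℂ, ‖z‖ ^ 2 = z.re ^ 2 + z.im ^ 2 := fun z => by
    rw [Complex.sq_norm, Complex.normSq_apply]; ring
  have hn : ∀ t x, ‖u t x‖ ^ 2 = a t x ^ 2 + b t x ^ 2 := fun t x => hns _
  have hn4 : ∀ t x, ‖u t x‖ ^ 4 = (a t x ^ 2 + b t x ^ 2) ^ 2 := fun t x => by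
    rw [← hn]; ring
  have hta : pdt a = fun t x => -pdx (pdx b) t x +
      ((a t x ^ 2 + b t x ^ 2) + e * (a t x ^ 2 + b t x ^ 2) ^ 2) * b t x := by
    ext t x
    have h := congrArg Complex.im (heq t x)
    rw [huxx, hut, hn, hn4, Complex.im_ofReal_mul] at h
    simp at h
    simp only [ha, hb]
    linarith
  have htb : pdt b = fun t x => pdx (pdx a) t x -
      ((a t x ^ 2 + b t x ^ 2) + e * (a t x ^ 2 + b t x ^ 2) ^ 2) * a t x := by
    ext t x
    have h := congrArg Complex.re (heq t x)
    rw [huxx, hut, hn, hn4, Complex.re_ofReal_mul] at h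
    simp at h
    simp only [ha, hb]
    linarith
  have hf : ∀ t x, HasDerivAt (fun x => (a t x ^ 2 + b t x ^ 2) + e * (a t x ^ 2 + b t x ^ 2) ^ 2)
      ((1 + 2 * e * (a t x ^ 2 + b t x ^ 2)) * (2 * (a t x * pdx a t x + b t x * pdx b t x))) x := by
    intro t x
    have ds := ((sa.hx t x).fun_pow 2).fun_add ((sb.hx t x).fun_pow 2)
    refine (ds.fun_add ((ds.fun_pow 2).const_mul e)).congr_deriv ?_
    norm_num
    ring
  have hu0 : ∀ t, u t 0 = 0 := by
    intro t
    have h := hodd t 0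
    rw [neg_zero] at h
    exact self_eq_neg.1 h
  refine ⟨pdx a, pdx b, pdx (pdx a), pdx (pdx b), pdx (pdx (pdx a)), pdx (pdx (pdx b)),
    { ca := sa.continuous, cb := sb.continuous, ca1 := sa1.continuous, cb1 := sb1.continuous,
      ca2 := sa2.continuous, cb2 := sb2.continuous, ca3 := sa3.continuous, cb3 := sb3.continuous,
      da := sa.hx, db := sb.hx, da1 := sa1.hx, db1 := sb1.hx, da2 := sa2.hx, db2 := sb2.hx,
      ta := ?_, tb := ?_, ta1 := ?_, tb1 := ?_, a0 := ?_, b0 := ?_, en := ?_,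
      E1 := hε1, eE := heE }⟩
  · intro t x
    exact (sa.ht t x).congr_deriv (by rw [hta])
  · intro t x
    exact (sb.ht t x).congr_deriv (by rw [htb])
  · intro t x
    refine (sa1.ht t x).congr_deriv ?_
    rw [sa.comm]
    have st : HasDerivAt (pdt a t) (pdx (pdt a) t x) x := by
      have h0 : ContDiff ℝ (⊤ : ℕ∞) (fderiv ℝ (Function.uncurry a)) := sa.fderiv_right (by simp)
      have h1 : Smooth2 (pdt a) := h0.clm_apply contDiff_const
      exact h1.hx t x
    refine st.unique ?_
    rw [hta]
    refine ((sb2.hx t x).fun_neg.fun_add ((hf t x).fun_mul (sb.hx t x))).congr_deriv ?_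
    ring
  · intro t x
    refine (sb1.ht t x).congr_deriv ?_
    rw [sb.comm]
    have st : HasDerivAt (pdt b t) (pdx (pdt b) t x) x := by
      have h0 : ContDiff ℝ (⊤ : ℕ∞) (fderiv ℝ (Function.uncurry b)) := sb.fderiv_right (by simp)
      have h1 : Smooth2 (pdt b) := h0.clm_apply contDiff_const
      exact h1.hx t x
    refine st.unique ?_
    rw [htb]
    refine ((sa2.hx t x).fun_sub ((hf t x).fun_mul (sa.hx t x))).congr_deriv ?_
    ring
  · intro t; simp [ha, hu0]
  · intro t; simp [hb, hu0]
  · intro t R hR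
    obtain ⟨g, hg⟩ := hS t
    have hug : u t = g := funext hg
    have i1 : Integrable fun x => ‖u t x‖ ^ 2 := by rw [hug]; exact schwartz_sq g
    have i2 : Integrable fun x => ‖deriv (u t) x‖ ^ 2 := by
      rw [hug]; exact schwartz_sq (SchwartzMap.derivCLM ℝ ℂ g)
    have hq : ∀ x, ‖deriv (u t) x‖ ^ 2 = pdx a t x ^ 2 + pdx b t x ^ 2 := by
      intro x
      rw [hns, hux]; simp
    rw [intervalIntegral.integral_of_le hR]
    refine le_trans ?_ (hen t)
    rw [← integral_add i1 i2]
    simp_rw [hq, hn]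
    have i3 := i1.add i2
    simp only [Pi.add_def, hq, hn] at i3
    exact setIntegral_le_integral i3 (Eventually.of_forall fun x => by
      simp only [Pi.zero_apply]; positivity)

/-- Corollary 1.2: decay of small odd solutions of the quintic perturbation of cubic NLS. -/
theorem decay_small_odd_perturbed_cubic_NLS
    (εt : ℝ) (hεt : εt ≠ 0) :
    ∃ ε > 0, ∀ u : ℝ → ℝ → ℂ,
      ContDiff ℝ (⊤ : ℕ∞) (Function.uncurry u) →
      (∀ t x : ℝ, Complex.I * deriv (fun s => u s x) t + deriv (deriv (u t)) x
          = ((‖u t x‖ ^ 2 + εt * ‖u t x‖ ^ 4 : ℝ) : ℂ) * u t x) →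
      (∀ t x : ℝ, u t (-x) = - u t x) →
      (∀ t : ℝ, ∃ g : SchwartzMap ℝ ℂ, ∀ x : ℝ, u t x = g x) →
      (∀ t : ℝ, (∫ x : ℝ, ‖u t x‖ ^ 2) + (∫ x : ℝ, ‖deriv (u t) x‖ ^ 2) ≤ ε ^ 2) →
      ∀ I : Set ℝ, I.OrdConnected → Bornology.IsBounded I →
        Tendsto (fun t : ℝ =>
            Real.sqrt (∫ x in I, ‖u t x‖ ^ 2) + (⨆ x ∈ I, ‖u t x‖))
          atTop (nhds 0) := by
  have hpos : 0 < 1 + |εt| := by positivity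
  refine ⟨1 / (2 * (1 + |εt|)), by positivity, ?_⟩
  intro u hu heq hodd hS hen I _ hI
  have hε2 : (1 / (2 * (1 + |εt|))) ^ 2 ≤ 1 := by
    rw [div_pow, div_le_one (by positivity)]
    nlinarith [abs_nonneg εt]
  have hεe : |εt| * (1 / (2 * (1 + |εt|))) ^ 2 ≤ 1 / 4 := by
    rw [div_pow, ← mul_div_assoc, div_le_div_iff₀ (by positivity) (by norm_num)]
    nlinarith [abs_nonneg εt]
  obtain ⟨a1, b1, a2, b2, a3, b3, S⟩ := sol_of εt _ hε2 hεe u hu heq hodd hS hen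
  obtain ⟨B, hB0, hB⟩ : ∃ B : ℝ, 0 < B ∧ I ⊆ Set.Icc (-B) B := by
    obtain ⟨B, hB0, hB⟩ := hI.subset_closedBall_lt 0 0
    exact ⟨B, hB0, by rwa [Real.closedBall_eq_Icc, zero_sub, zero_add] at hB⟩
  have key : ∀ η : ℝ, 0 < η → ∀ᶠ t in atTop, ∀ x ∈ Set.Icc (-B) B, ‖u t x‖ ≤ η := by
    intro η hη
    filter_upwards [S.decay hB0.le (show 0 < η ^ 2 by positivity)] with t ht
    have hp : ∀ x ∈ Set.Icc 0 B, ‖u t x‖ ≤ η := by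
      intro x hx
      have h := ht x hx
      have hn : ‖u t x‖ ^ 2 = (u t x).re ^ 2 + (u t x).im ^ 2 := by
        rw [Complex.sq_norm, Complex.normSq_apply]; ring
      rw [← hn] at h
      exact (sq_le_sq₀ (norm_nonneg _) hη.le).1 h
    intro x hx
    rcases le_total 0 x with h | h
    · exact hp x ⟨h, hx.2⟩
    · have := hp (-x) ⟨by linarith, by linarith [hx.1]⟩
      rwa [hodd, norm_neg] at this
  have hnn : ∀ t, 0 ≤ ⨆ x ∈ I, ‖u t x‖ := fun t =>
    Real.iSup_nonneg fun x => Real.iSup_nonneg fun _ => norm_nonneg _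
  rw [Metric.tendsto_atTop']
  intro η hη
  have hc : 0 < 1 + √(2 * B) := by positivity
  set δ := η / (2 * (1 + √(2 * B))) with hδ
  have hδ0 : 0 < δ := by positivity
  obtain ⟨T, hT⟩ := eventually_atTop.1 (key δ hδ0)
  refine ⟨T, fun t ht => ?_⟩
  have h := hT t ht.le
  have hsup : (⨆ x ∈ I, ‖u t x‖) ≤ δ :=
    Real.iSup_le (fun x => Real.iSup_le (fun hx => h x (hB hx)) hδ0.le) hδ0.le
  have cont : Continuous fun x => ‖u t x‖ ^ 2 := by
    have : Continuous (u t) := hu.continuous.comp (by fun_prop : Continuous fun x : ℝ => (t, x))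
    fun_prop
  have hNint : (∫ x in I, ‖u t x‖ ^ 2) ≤ δ ^ 2 * (2 * B) := by
    calc (∫ x in I, ‖u t x‖ ^ 2) ≤ ∫ x in Set.Icc (-B) B, ‖u t x‖ ^ 2 :=
          setIntegral_mono_set cont.integrableOn_Icc
            (Eventually.of_forall fun x => by positivity) (LE.le.eventuallyLE hB)
      _ ≤ ∫ x in Set.Icc (-B) B, δ ^ 2 := by
          apply setIntegral_mono_on cont.integrableOn_Icc (by simp) measurableSet_Icc
          intro x hx
          exact pow_le_pow_left₀ (norm_nonneg _) (h x hx) 2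
      _ = δ ^ 2 * (2 * B) := by
          simp [Real.volume_real_Icc]
          rw [max_eq_left (by linarith)]; ring
  have hsq : √(∫ x in I, ‖u t x‖ ^ 2) ≤ δ * √(2 * B) := by
    calc _ ≤ √(δ ^ 2 * (2 * B)) := Real.sqrt_le_sqrt hNint
      _ = _ := by rw [Real.sqrt_mul (by positivity), Real.sqrt_sq hδ0.le]
  rw [Real.dist_eq, sub_zero, abs_of_nonneg (add_nonneg (Real.sqrt_nonneg _) (hnn t))]
  have : δ * (1 + √(2 * B)) = η / 2 := by rw [hδ]; field_simp
  linarith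
end
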